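/- Suppose 𝕂 is a computable age with HP, JEP, and coAP. Then 𝕂 has an EmbedInfo(𝕂)''-computable cofinal Fraïssé limit, where EmbedInfo(𝕂)'' denotes the double Turing jump of the degree of EmbedInfo(𝕂). -/

import Mathlib

/- Self-contained framework for computable ages and cofinal Fraïssé limits. -/

namespace CFL

open Classical

/-! ### Oracle computability -/

/-- The characteristic partial function of a set of naturals. -/
noncomputable def chi (A : Set ℕ) : ℕ →. ℕ :=
  fun n => Part.some (if n ∈ A then 1 else 0)

/-- Codes for oracle partial recursive functions. -/
inductive OCode : Type
  | zero : OCode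
  | succ : OCode
  | left : OCode
  | right : OCode
  | oracle : OCode
  | pair : OCode → OCode → OCode
  | comp : OCode → OCode → OCode
  | prec : OCode → OCode → OCode
  | rfind' : OCode → OCode

/-- Evaluation of an oracle code relative to an oracle `O`. -/
def OCode.eval (O : ℕ →. ℕ) : OCode → ℕ →. ℕ
  | OCode.zero => pure 0
  | OCode.succ => Nat.succ
  | OCode.left => ↑fun n : ℕ => n.unpair.1
  | OCode.right => ↑fun n : ℕ => n.unpair.2
  | OCode.oracle => O
  | OCode.pair cf cg => fun n => Nat.pair <$> OCode.eval O cf n <*> OCode.eval O cg n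
  | OCode.comp cf cg => fun n => OCode.eval O cg n >>= OCode.eval O cf
  | OCode.prec cf cg =>
    Nat.unpaired fun a n =>
      n.rec (OCode.eval O cf a) fun y IH => do
        let i ← IH
        OCode.eval O cg (Nat.pair a (Nat.pair y i))
  | OCode.rfind' cf =>
    Nat.unpaired fun a m =>
      (Nat.rfind fun n => (fun m => m = 0) <$> OCode.eval O cf (Nat.pair a (n + m))).map
        (· + m)

/-- A numerical code of an `OCode`. -/
def OCode.encodeCode : OCode → ℕ
  | OCode.zero => 0
  | OCode.succ => 1
  | OCode.left => 2
  | OCode.right => 3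
  | OCode.oracle => 4
  | OCode.pair cf cg => 4 * Nat.pair cf.encodeCode cg.encodeCode + 5
  | OCode.comp cf cg => 4 * Nat.pair cf.encodeCode cg.encodeCode + 6
  | OCode.prec cf cg => 4 * Nat.pair cf.encodeCode cg.encodeCode + 7
  | OCode.rfind' cf => 4 * cf.encodeCode + 8

/-- `f` is a partial function recursive in the oracle set `O`. -/
def RecFunIn (O : Set ℕ) (f : ℕ →. ℕ) : Prop :=
  ∃ c : OCode, OCode.eval (chi O) c = f

/-- The code `c` computes the total function `f` relative to the oracle set `O`. -/
def ComputesIn (O : Set ℕ) (c : OCode) (f : ℕ → ℕ) : Prop :=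
  ∀ n, OCode.eval (chi O) c n = Part.some (f n)

/-- `f` is a total function computable in the oracle set `O`. -/
def TotalComputableIn (O : Set ℕ) (f : ℕ → ℕ) : Prop :=
  ∃ c : OCode, ComputesIn O c f

/-- The set `A` is computable in the oracle set `O`. -/
def SetRecIn (O A : Set ℕ) : Prop := RecFunIn O (chi A)

/-- Turing reducibility (on sets of naturals, regarded as representatives of
Turing degrees). -/
def TuringLE (A B : Set ℕ) : Prop := SetRecIn B A

/-- The set `A` is computably enumerable in the oracle set `O`. -/
def CEIn (O A : Set ℕ) : Prop :=
  ∃ c : OCode, ∀ n, n ∈ A ↔ (OCode.eval (chi O) c n).Dom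

/-- The Turing jump of a set of naturals. -/
def jump (O : Set ℕ) : Set ℕ :=
  { e | ∃ c : OCode, c.encodeCode = (Nat.unpair e).1 ∧
      (OCode.eval (chi O) c (Nat.unpair e).2).Dom }

/-- `0'`, the jump of the least degree. -/
def zeroJump : Set ℕ := jump ∅

/-- `0''`. -/
def zeroJump2 : Set ℕ := jump zeroJump

/-- `0'''`. -/
def zeroJump3 : Set ℕ := jump zeroJump2

/-! ### Languages and structures -/

/-- A (coded) first-order language: `relArity r = some k` means that `r` is the code of a
relation symbol of arity `k`, and similarly for function symbols. -/
structure Lang where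
  relArity : ℕ → Option ℕ
  funArity : ℕ → Option ℕ

/-- The language is computably represented. -/
def Lang.ComputableRep (L : Lang) : Prop :=
  TotalComputableIn ∅ (fun r => Encodable.encode (L.relArity r)) ∧
  TotalComputableIn ∅ (fun f => Encodable.encode (L.funArity f))

/-- A finite relational language. -/
def Lang.FiniteRelational (L : Lang) : Prop :=
  (∀ f, L.funArity f = none) ∧ { r | (L.relArity r).isSome = true }.Finite

/-- A finite language. -/
def Lang.FiniteLang (L : Lang) : Prop :=
  { r | (L.relArity r).isSome = true }.Finite ∧
  { f | (L.funArity f).isSome = true }.Finite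

/-- An `L`-structure with underlying set a set of naturals. -/
structure Str (L : Lang) where
  dom : Set ℕ
  rel : ℕ → List ℕ → Prop
  fn : ℕ → List ℕ → ℕ
  rel_valid : ∀ r as, rel r as → L.relArity r = some as.length ∧ ∀ x ∈ as, x ∈ dom
  fn_mem : ∀ f as, L.funArity f = some as.length → (∀ x ∈ as, x ∈ dom) → fn f as ∈ dom

variable {L : Lang}

/-- The (finite) tuple `as` lies in the structure `A`. -/
def TupleIn (A : Str L) (as : List ℕ) : Prop := ∀ x ∈ as, x ∈ A.dom

/-- Membership in the substructure of `A` generated by the tuple `s`. -/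
inductive InClosure (A : Str L) (s : List ℕ) : ℕ → Prop
  | base {x : ℕ} : x ∈ s → x ∈ A.dom → InClosure A s x
  | fn (f : ℕ) (as : List ℕ) : L.funArity f = some as.length →
      (∀ x ∈ as, InClosure A s x) → InClosure A s (A.fn f as)

theorem InClosure.mem_dom {A : Str L} {s : List ℕ} {x : ℕ}
    (h : InClosure A s x) : x ∈ A.dom := by
  induction h with
  | base _ hx => exact hx
  | fn f as ha _ ih => exact A.fn_mem f as ha ih

/-- The substructure of `A` generated by the tuple `s`. -/
def Str.sub (A : Str L) (s : List ℕ) : Str L where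
  dom := { x | InClosure A s x }
  rel r as := A.rel r as ∧ ∀ x ∈ as, InClosure A s x
  fn := A.fn
  rel_valid := fun r as h => ⟨(A.rel_valid r as h.1).1, h.2⟩
  fn_mem := fun f as ha hm => InClosure.fn f as ha hm

/-- `h` is an embedding of `A` into `B`. -/
def IsEmbMap (A B : Str L) (h : ℕ → ℕ) : Prop :=
  (∀ x ∈ A.dom, h x ∈ B.dom) ∧
  (∀ x ∈ A.dom, ∀ y ∈ A.dom, h x = h y → x = y) ∧
  (∀ r as, TupleIn A as → (A.rel r as ↔ B.rel r (as.map h))) ∧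
  (∀ f as, L.funArity f = some as.length → TupleIn A as →
    h (A.fn f as) = B.fn f (as.map h))

/-- `A` embeds into `B`. -/
def Embeds (A B : Str L) : Prop := ∃ h, IsEmbMap A B h

/-- `h` is an isomorphism of `A` onto `B`. -/
def IsIsoMap (A B : Str L) (h : ℕ → ℕ) : Prop :=
  IsEmbMap A B h ∧ ∀ y ∈ B.dom, ∃ x ∈ A.dom, h x = y

/-- `A` and `B` are isomorphic. -/
def Isom (A B : Str L) : Prop := ∃ h, IsIsoMap A B h

/-- `as ∼cl bs`: the coordinatewise map extends to an isomorphism of generated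
substructures. -/
def ClSim (A : Str L) (as : List ℕ) (B : Str L) (bs : List ℕ) : Prop :=
  ∃ h : ℕ → ℕ, as.map h = bs ∧ IsIsoMap (A.sub as) (B.sub bs) h

/-- `as ∼tuple bs`: equal length and the same pattern of equalities among coordinates. -/
def TupleSim (as bs : List ℕ) : Prop :=
  ∃ h h' : ℕ → ℕ, as.map h = bs ∧ bs.map h' = as

/-- `A` is finitely generated. -/
def Str.FG (A : Str L) : Prop :=
  ∃ s : List ℕ, TupleIn A s ∧ ∀ x, x ∈ A.dom ↔ InClosure A s x

/-- `g` is an automorphism of `M`. -/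
def IsAutoOf (M : Str L) (g : ℕ → ℕ) : Prop := IsIsoMap M M g

/-! ### Ages (as isomorphism-closed classes) -/

/-- `B` belongs to the age of `M`, i.e. `B` is isomorphic to a finitely generated
substructure of `M`. -/
def AgeMemOf (M : Str L) (B : Str L) : Prop :=
  ∃ as : List ℕ, TupleIn M as ∧ Isom B (M.sub as)

/-- The age of a structure `M`. -/
def ageOf (M : Str L) : Set (Str L) := { B | AgeMemOf M B }

/-- The hereditary property. -/
def HP (C : Set (Str L)) : Prop :=
  ∀ B ∈ C, ∀ as : List ℕ, TupleIn B as → B.sub as ∈ C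

/-- The joint embedding property. -/
def JEP (C : Set (Str L)) : Prop :=
  ∀ A ∈ C, ∀ B ∈ C, ∃ D ∈ C, Embeds A D ∧ Embeds B D

/-- Every pair of embeddings with domain `A` into members of `C` can be amalgamated
over `A` inside `C`. -/
def AmalgamatesOver (C : Set (Str L)) (A : Str L) : Prop :=
  ∀ B₀ ∈ C, ∀ B₁ ∈ C, ∀ f₀ f₁ : ℕ → ℕ, IsEmbMap A B₀ f₀ → IsEmbMap A B₁ f₁ →
    ∃ D ∈ C, ∃ g₀ g₁ : ℕ → ℕ, IsEmbMap B₀ D g₀ ∧ IsEmbMap B₁ D g₁ ∧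
      ∀ x ∈ A.dom, g₀ (f₀ x) = g₁ (f₁ x)

/-- The amalgamation property. -/
def AP (C : Set (Str L)) : Prop := ∀ A ∈ C, AmalgamatesOver C A

/-- `A` is an amalgamation base of the class `C`. -/
def AmalgBase (C : Set (Str L)) (A : Str L) : Prop := A ∈ C ∧ AmalgamatesOver C A

/-- The cofinal amalgamation property. -/
def CoAP (C : Set (Str L)) : Prop :=
  ∀ A ∈ C, ∃ A' : Str L, AmalgBase C A' ∧ Embeds A A'

/-! ### Computable ages -/

/-- An (abstract) enumerated age: for each index `i`, a generating tuple `tup i` and the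
structure `str i` it generates. -/
structure CompAge (L : Lang) where
  tup : ℕ → List ℕ
  str : ℕ → Str L
  tup_mem : ∀ i, TupleIn (str i) (tup i)
  gen : ∀ i x, x ∈ (str i).dom ↔ InClosure (str i) (tup i) x

/-- The class of structures represented by the enumerated age `K`. -/
def CompAge.cls (K : CompAge L) : Set (Str L) := { B | ∃ i, Isom B (K.str i) }

/-- The structure `M` is computable in the oracle set `s`. -/
def StrComputableIn (s : Set ℕ) (M : Str L) : Prop :=
  SetRecIn s M.dom ∧
  SetRecIn s { p | ∃ r as, TupleIn M as ∧ M.rel r as ∧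
      p = Nat.pair r (Encodable.encode as) } ∧
  SetRecIn s { p | ∃ f as b, L.funArity f = some as.length ∧ TupleIn M as ∧
      M.fn f as = b ∧ p = Nat.pair f (Nat.pair (Encodable.encode as) b) }

/-- The coded diagram of an enumerated age. -/
def CompAge.diag (K : CompAge L) : Set ℕ :=
  { p | ∃ i, p = Nat.pair 0 (Nat.pair i (Encodable.encode (K.tup i))) } ∪
  { p | ∃ i x, x ∈ (K.str i).dom ∧ p = Nat.pair 1 (Nat.pair i x) } ∪
  { p | ∃ i r as, TupleIn (K.str i) as ∧ (K.str i).rel r as ∧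
      p = Nat.pair 2 (Nat.pair i (Nat.pair r (Encodable.encode as))) } ∪
  { p | ∃ i r as, TupleIn (K.str i) as ∧ L.relArity r = some as.length ∧
      ¬ (K.str i).rel r as ∧
      p = Nat.pair 3 (Nat.pair i (Nat.pair r (Encodable.encode as))) } ∪
  { p | ∃ i f as b, TupleIn (K.str i) as ∧ L.funArity f = some as.length ∧
      (K.str i).fn f as = b ∧
      p = Nat.pair 4 (Nat.pair i (Nat.pair f (Nat.pair (Encodable.encode as) b))) }

/-- `K` is an `s`-computable age: its diagram is c.e. in `s` and each of its structures
is computable in `s`. -/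
def AgeComputableIn (s : Set ℕ) (K : CompAge L) : Prop :=
  CEIn s K.diag ∧ ∀ i, StrComputableIn s (K.str i)

/-- The embedding information of an enumerated age, as a set of naturals. -/
def EmbedInfo (K : CompAge L) : Set ℕ :=
  { p | ∃ k₀ b₀ k₁ b₁, TupleIn (K.str k₀) b₀ ∧ TupleIn (K.str k₁) b₁ ∧
      ClSim (K.str k₀) b₀ (K.str k₁) b₁ ∧
      p = Nat.pair k₀ (Nat.pair (Encodable.encode b₀)
            (Nat.pair k₁ (Encodable.encode b₁))) }

/-! ### Potential embeddings, spans, and amalgamation diagrams -/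

/-- A potential embedding: a pair of indices and a tuple in the codomain structure. -/
structure PotEmb where
  i : ℕ
  j : ℕ
  c : List ℕ

/-- A numerical code of a potential embedding. -/
def PotEmb.code (F : PotEmb) : ℕ :=
  Nat.pair F.i (Nat.pair F.j (Encodable.encode F.c))

/-- The potential embedding is well-formed with respect to `K`. -/
def PotEmb.Valid (K : CompAge L) (F : PotEmb) : Prop :=
  F.c.length = (K.tup F.i).length ∧ TupleIn (K.str F.j) F.c

/-- The potential embedding is an embedding. -/
def PotEmb.IsEmb (K : CompAge L) (F : PotEmb) : Prop :=
  ClSim (K.str F.i) (K.tup F.i) (K.str F.j) F.c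

/-- The potential embedding is an isomorphism (its range generates the codomain). -/
def PotEmb.IsIso (K : CompAge L) (F : PotEmb) : Prop :=
  F.IsEmb K ∧ ∀ x ∈ (K.str F.j).dom, InClosure (K.str F.j) F.c x

/-- `h` realizes the potential embedding `F` as a map on the domain structure. -/
def ExtMap (K : CompAge L) (F : PotEmb) (h : ℕ → ℕ) : Prop :=
  (K.tup F.i).map h = F.c ∧ IsEmbMap (K.str F.i) (K.str F.j) h

/-- `(F₀, F₁)` is a potential span. -/
def PotSpan (K : CompAge L) (F₀ F₁ : PotEmb) : Prop :=
  F₀.Valid K ∧ F₁.Valid K ∧ F₀.i = F₁.i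

/-- `(G₀, G₁)` is an amalgamation diagram over the potential span `(F₀, F₁)`. -/
def AmalgDiagOver (K : CompAge L) (F₀ F₁ G₀ G₁ : PotEmb) : Prop :=
  G₀.Valid K ∧ G₁.Valid K ∧ G₀.IsEmb K ∧
  G₀.i = F₀.j ∧ G₁.i = F₁.j ∧ G₀.j = G₁.j ∧
  (F₀.IsEmb K → F₁.IsEmb K → G₁.IsEmb K ∧
    ∀ h₀ h₁ : ℕ → ℕ, ExtMap K G₀ h₀ → ExtMap K G₁ h₁ →
      F₀.c.map h₀ = F₁.c.map h₁)

/-- `H` is the composition `F ∘ G` of potential embeddings (where `F` is an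
embedding realized by any `h` extending it). -/
def CompRel (K : CompAge L) (F G H : PotEmb) : Prop :=
  G.j = F.i ∧ H.i = G.i ∧ H.j = F.j ∧
  ∀ h : ℕ → ℕ, ExtMap K F h → H.c = G.c.map h

/-! ### Computable versions of HP, JEP, AP, coAP -/

/-- The `s`-computable hereditary property. -/
def CHP (s : Set ℕ) (K : CompAge L) : Prop :=
  ∃ c : OCode, ∀ i (b : List ℕ), TupleIn (K.str i) b →
    ∃ j, OCode.eval (chi s) c (Nat.pair i (Encodable.encode b)) = Part.some j ∧
      ClSim (K.str j) (K.tup j) (K.str i) b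

/-- The `s`-computable joint embedding property. -/
def CJEP (s : Set ℕ) (K : CompAge L) : Prop :=
  ∃ c : OCode, ∀ i j : ℕ, ∃ F G : PotEmb,
    OCode.eval (chi s) c (Nat.pair i j) = Part.some (Nat.pair F.code G.code) ∧
    F.Valid K ∧ G.Valid K ∧ F.IsEmb K ∧ G.IsEmb K ∧
    F.i = i ∧ G.i = j ∧ F.j = G.j

/-- The `s`-computable amalgamation property. -/
def CAP (s : Set ℕ) (K : CompAge L) : Prop :=
  ∃ c : OCode, ∀ F₀ F₁ : PotEmb, PotSpan K F₀ F₁ →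
    ∃ G₀ G₁ : PotEmb,
      OCode.eval (chi s) c (Nat.pair F₀.code F₁.code) =
        Part.some (Nat.pair G₀.code G₁.code) ∧
      AmalgDiagOver K F₀ F₁ G₀ G₁

/-- A family `W` of distinguished embeddings with amalgamation-base codomains, closed
under pre/post composition with isomorphisms, covering all domains. -/
def IsCoAPFamily (K : CompAge L) (W : Set PotEmb) : Prop :=
  (∀ F ∈ W, F.Valid K ∧ F.IsEmb K ∧ AmalgBase K.cls (K.str F.j)) ∧
  (∀ F ∈ W, ∀ G H : PotEmb, G.Valid K → G.IsIso K → G.j = F.i →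
      CompRel K F G H → H ∈ W) ∧
  (∀ F ∈ W, ∀ G H : PotEmb, G.Valid K → G.IsIso K → G.i = F.j →
      CompRel K G F H → H ∈ W) ∧
  (∀ i : ℕ, ∃ F ∈ W, F.i = i)

/-- The `s`-computable cofinal amalgamation property: there is an `s`-c.e. family of
distinguished embeddings onto amalgamation bases together with an `s`-computable
amalgamation function. -/
def CcoAP (s : Set ℕ) (K : CompAge L) : Prop :=
  ∃ W : Set PotEmb, IsCoAPFamily K W ∧
    CEIn s { p | ∃ F ∈ W, p = F.code } ∧
    ∃ c : OCode, ∀ F ∈ W, ∀ G₀ G₁ : PotEmb,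
      G₀.Valid K → G₁.Valid K → G₀.i = F.j → G₁.i = F.j →
      ∃ D₀ D₁ : PotEmb,
        OCode.eval (chi s) c (Nat.pair F.code (Nat.pair G₀.code G₁.code)) =
          Part.some (Nat.pair D₀.code D₁.code) ∧
        AmalgDiagOver K G₀ G₁ D₀ D₁

/-! ### Ultrahomogeneity -/

/-- `M` is ultrahomogeneous: every isomorphism between finitely generated substructures
extends to an automorphism. -/
def Ultrahomogeneous (M : Str L) : Prop :=
  ∀ as bs : List ℕ, TupleIn M as → TupleIn M bs → ClSim M as M bs →
    ∃ g : ℕ → ℕ, IsAutoOf M g ∧ as.map g = bs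

/-- `g` is a bijection of the underlying set of `M` with itself. -/
def BijOnDom (M : Str L) (g : ℕ → ℕ) : Prop :=
  (∀ x ∈ M.dom, g x ∈ M.dom) ∧
  (∀ x ∈ M.dom, ∀ y ∈ M.dom, g x = g y → x = y) ∧
  (∀ y ∈ M.dom, ∃ x ∈ M.dom, g x = y)

/-- `M` is `s`-computably ultrahomogeneous. -/
def CompUltrahom (s : Set ℕ) (M : Str L) : Prop :=
  ∃ c : OCode, ∀ as bs : List ℕ, TupleIn M as → TupleIn M bs →
    as.length = bs.length →
    ∃ e : ℕ,
      OCode.eval (chi s) c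
          (Nat.pair (Encodable.encode as) (Encodable.encode bs)) = Part.some e ∧
      ∃ c' : OCode, c'.encodeCode = e ∧ ∃ g : ℕ → ℕ, ComputesIn s c' g ∧
        BijOnDom M g ∧
        (ClSim M as M bs → IsAutoOf M g ∧ as.map g = bs)

/-! ### Cofinal ultrahomogeneity -/

/-- `M` is cofinally ultrahomogeneous. -/
def CofinallyUltrahomogeneous (M : Str L) : Prop :=
  ∀ as : List ℕ, TupleIn M as → ∃ bs : List ℕ, TupleIn M bs ∧
    (∀ x ∈ as, InClosure M bs x) ∧
    ∀ cs : List ℕ, TupleIn M cs → ClSim M bs M cs →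
      ∃ g : ℕ → ℕ, IsAutoOf M g ∧ bs.map g = cs

/-- `E` is a cofinal collection of tuples in `M`. -/
def IsCofinalCollection (M : Str L) (E : Set (List ℕ)) : Prop :=
  (∀ bs ∈ E, TupleIn M bs) ∧
  (∀ as : List ℕ, TupleIn M as → ∃ bs ∈ E, ∀ x ∈ as, InClosure M bs x) ∧
  (∀ bs ∈ E, ∀ as : List ℕ, (∀ x ∈ as, InClosure M bs x) → (as ++ bs) ∈ E) ∧
  (∀ as ∈ E, ∀ bs : List ℕ, TupleIn M bs → ClSim M as M bs → bs ∈ E)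

/-- `M` is cofinally ultrahomogeneous for the collection `E`: every isomorphism between
substructures generated by members of `E` extends to an automorphism. -/
def CofUltraFor (M : Str L) (E : Set (List ℕ)) : Prop :=
  ∀ as ∈ E, ∀ bs ∈ E, ClSim M as M bs →
    ∃ g : ℕ → ℕ, IsAutoOf M g ∧ as.map g = bs

/-- The set of codes of members of `E`. -/
def ECodes (E : Set (List ℕ)) : Set ℕ := { p | ∃ as ∈ E, p = Encodable.encode as }

/-- The functional part of `s`-computable cofinal ultrahomogeneity with respect to `E`. -/
def CofUltraFunIn (s : Set ℕ) (M : Str L) (E : Set (List ℕ)) : Prop :=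
  ∃ c : OCode, ∀ as ∈ E, ∀ bs : List ℕ, TupleIn M bs → TupleSim as bs →
    ∃ e : ℕ,
      OCode.eval (chi s) c
          (Nat.pair (Encodable.encode as) (Encodable.encode bs)) = Part.some e ∧
      ∃ c' : OCode, c'.encodeCode = e ∧ ∃ g : ℕ → ℕ, ComputesIn s c' g ∧
        BijOnDom M g ∧ as.map g = bs ∧
        (ClSim M as M bs → IsAutoOf M g)

/-- `M` is `s`-computably cofinally ultrahomogeneous with respect to `E`. -/
def CompCofUltrahomWrt (s : Set ℕ) (M : Str L) (E : Set (List ℕ)) : Prop :=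
  IsCofinalCollection M E ∧ SetRecIn s (ECodes E) ∧ CofUltraFunIn s M E

/-- `M` is `s`-computably cofinally ultrahomogeneous. -/
def CompCofUltrahom (s : Set ℕ) (M : Str L) : Prop :=
  ∃ E : Set (List ℕ), CompCofUltrahomWrt s M E

/-- The `s`-computable cofinal extension property with respect to `E`. -/
def CompCofExtProp (s : Set ℕ) (M : Str L) (E : Set (List ℕ)) : Prop :=
  ∃ c : OCode, ∀ as bs cs : List ℕ, as ∈ E → cs ∈ E → TupleIn M bs →
    (∀ x ∈ as, InClosure M cs x) → TupleSim as bs →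
    ∃ ds : List ℕ,
      OCode.eval (chi s) c
          (Nat.pair (Encodable.encode as)
            (Nat.pair (Encodable.encode bs) (Encodable.encode cs))) =
        Part.some (Encodable.encode ds) ∧
      TupleIn M ds ∧ TupleSim (as ++ cs) (bs ++ ds) ∧
      (ClSim M as M bs →
        ClSim M ds M cs ∧ (∀ x ∈ bs, InClosure M ds x) ∧
        ∀ h h' : ℕ → ℕ,
          ds.map h = cs → IsIsoMap (M.sub ds) (M.sub cs) h →
          bs.map h' = as → IsIsoMap (M.sub bs) (M.sub as) h' →
          bs.map h = bs.map h')

/-! ### Canonical ages and limits -/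

/-- `K` is a canonical age of `M` (relative to the oracle `t`): the enumeration of
generating tuples is `t`-computable, lists every finite tuple of `M` infinitely often,
and `str i` is the substructure generated by `tup i`. -/
def IsCanonicalAgeOf (t : Set ℕ) (K : CompAge L) (M : Str L) : Prop :=
  TotalComputableIn t (fun i => Encodable.encode (K.tup i)) ∧
  (∀ i, TupleIn M (K.tup i)) ∧
  (∀ as : List ℕ, TupleIn M as → ∀ n : ℕ, ∃ i, n ≤ i ∧ K.tup i = as) ∧
  (∀ i, K.str i = M.sub (K.tup i))

/-- `K` represents the age of `M`. -/
def RepresentsAgeOf (K : CompAge L) (M : Str L) : Prop :=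
  (∀ i, AgeMemOf M (K.str i)) ∧
  (∀ B : Str L, AgeMemOf M B → ∃ i, Isom B (K.str i))

/-- `M` is a cofinal Fraïssé limit of (the age represented by) `K`. -/
def CofinalFraisseLimitOf (K : CompAge L) (M : Str L) : Prop :=
  CofinallyUltrahomogeneous M ∧ RepresentsAgeOf K M

/-- The enumerated age `K` is uniformly finite. -/
def UniformlyFinite (K : CompAge L) : Prop :=
  L.FiniteLang ∧ ∃ f : ℕ → ℕ, TotalComputableIn ∅ f ∧
    ∀ i, ∀ as : List ℕ, TupleIn (K.str i) as →
      { x | InClosure (K.str i) as x }.Finite ∧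
      { x | InClosure (K.str i) as x }.ncard ≤ f as.length


/-! ### Relative computability -/

theorem OCode.encodeCode_injective : Function.Injective OCode.encodeCode := by
  intro c
  induction c with
  | pair a b iha ihb =>
    intro d h
    cases d <;> simp only [OCode.encodeCode] at h <;> try omega
    rename_i c d
    have h1 : Nat.pair a.encodeCode b.encodeCode = Nat.pair c.encodeCode d.encodeCode := by omega
    have h' := Nat.pair_eq_pair.1 h1
    rw [iha h'.1, ihb h'.2]
  | comp a b iha ihb =>
    intro d h
    cases d <;> simp only [OCode.encodeCode] at h <;> try omega
    rename_i c d
    have h1 : Nat.pair a.encodeCode b.encodeCode = Nat.pair c.encodeCode d.encodeCode := by omega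
    have h' := Nat.pair_eq_pair.1 h1
    rw [iha h'.1, ihb h'.2]
  | prec a b iha ihb =>
    intro d h
    cases d <;> simp only [OCode.encodeCode] at h <;> try omega
    rename_i c d
    have h1 : Nat.pair a.encodeCode b.encodeCode = Nat.pair c.encodeCode d.encodeCode := by omega
    have h' := Nat.pair_eq_pair.1 h1
    rw [iha h'.1, ihb h'.2]
  | rfind' a iha =>
    intro d h
    cases d <;> simp only [OCode.encodeCode] at h <;> try omega
    rename_i d
    have h1 : a.encodeCode = d.encodeCode := by omega
    rw [iha h1]
  | _ =>
    intro d h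
    cases d <;> simp only [OCode.encodeCode] at h <;> first | rfl | omega

noncomputable instance instPrimcodableProp : Primcodable Prop :=
  Primcodable.ofEquiv Bool Equiv.propEquivBool

theorem encode_prop (p : Prop) : Encodable.encode p = if p then 1 else 0 := by
  have : Encodable.encode p = Encodable.encode (decide p) := rfl
  rw [this]
  by_cases h : p <;> simp [h]

theorem primrec_prop {α : Type*} [Primcodable α] {p : α → Prop} :
    PrimrecPred p ↔ Primrec p := by
  have h : ∀ q : α → Prop, Primrec (fun a => decide (q a)) ↔ Primrec q := by
    intro q
    rw [← Primrec.encode_iff, ← Primrec.encode_iff (f := q)]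
    rfl
  rw [← h, primrecPred_iff_primrec_decide]

/-- `f` is computable relative to the oracle set `O`. -/
@[fun_prop]
def CompIn {α β : Type*} [Primcodable α] [Primcodable β] (O : Set ℕ) (f : α → β) : Prop :=
  ∃ c : OCode, ∀ a, OCode.eval (chi O) c (Encodable.encode a) = Part.some (Encodable.encode (f a))

namespace OCode

variable {O : ℕ →. ℕ}

theorem eval_comp {cf cg : OCode} {n m : ℕ} (h : eval O cg n = Part.some m) :
    eval O (comp cf cg) n = eval O cf m := by
  change (eval O cg n >>= eval O cf) = _
  rw [h]
  exact Part.bind_some m _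

theorem eval_pair {cf cg : OCode} {n a b : ℕ} (hf : eval O cf n = Part.some a)
    (hg : eval O cg n = Part.some b) : eval O (pair cf cg) n = Part.some (Nat.pair a b) := by
  change (Nat.pair <$> eval O cf n <*> eval O cg n) = _
  rw [hf, hg]
  simp [Seq.seq]

theorem eval_left (n : ℕ) : eval O left n = Part.some n.unpair.1 := rfl

theorem eval_right (n : ℕ) : eval O right n = Part.some n.unpair.2 := rfl

theorem eval_id (n : ℕ) : eval O (pair left right) n = Part.some n := by
  rw [eval_pair (eval_left n) (eval_right n), Nat.pair_unpair]

theorem eval_zero (n : ℕ) : eval O zero n = Part.some 0 := rfl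

theorem evalPrec {cf cg : OCode} {a : ℕ} (g : ℕ → ℕ) (h0 : eval O cf a = Part.some (g 0))
    (hs : ∀ y, eval O cg (Nat.pair a (Nat.pair y (g y))) = Part.some (g (y + 1))) (n : ℕ) :
    eval O (prec cf cg) (Nat.pair a n) = Part.some (g n) := by
  have h : ∀ n : ℕ, (Nat.rec (motive := fun _ => Part ℕ) (eval O cf a) (fun y IH => IH >>= fun i =>
        eval O cg (Nat.pair a (Nat.pair y i))) n) = Part.some (g n) := by
    intro n
    induction n with
    | zero => exact h0
    | succ k ih =>
      change (Nat.rec (motive := fun _ => Part ℕ) (eval O cf a) (fun y IH => IH >>= fun i =>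
        eval O cg (Nat.pair a (Nat.pair y i))) k >>= fun i =>
          eval O cg (Nat.pair a (Nat.pair k i))) = _
      rw [ih]
      exact (Part.bind_some _ _).trans (hs k)
  simp only [eval, Nat.unpaired, Nat.unpair_pair]
  exact h n

/-- A code searching for the least `n` such that `cf` vanishes at `(a, n)`. -/
def search (cf : OCode) : OCode := comp (rfind' cf) (pair (pair left right) zero)

theorem eval_search {cf : OCode} {a : ℕ} (g : ℕ → ℕ)
    (h : ∀ n, eval O cf (Nat.pair a n) = Part.some (g n)) :
    eval O (search cf) a = Nat.rfind fun n => Part.some (decide (g n = 0)) := by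
  rw [search, eval_comp (eval_pair (eval_id a) (eval_zero a))]
  simp only [eval, Nat.unpaired, Nat.unpair_pair, h, Nat.add_zero]
  have e : ∀ p : Part ℕ, Part.map (fun x => x) p = p := fun p => Part.map_id' (fun _ => rfl) p
  rw [e]
  congr 1

/-- Replace the oracle by a code. -/
def subst (d : OCode) : OCode → OCode
  | oracle => d
  | zero => zero
  | succ => succ
  | left => left
  | right => right
  | pair a b => pair (subst d a) (subst d b)
  | comp a b => comp (subst d a) (subst d b)
  | prec a b => prec (subst d a) (subst d b)
  | rfind' a => rfind' (subst d a)

theorem eval_subst {O' : ℕ →. ℕ} {d : OCode} (h : eval O' d = O) (c : OCode) :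
    eval O' (subst d c) = eval O c := by
  induction c with
  | oracle => exact h
  | zero => rfl
  | succ => rfl
  | left => rfl
  | right => rfl
  | pair a b iha ihb => simp only [subst, eval, iha, ihb]; rfl
  | comp a b iha ihb => simp only [subst, eval, iha, ihb]; rfl
  | prec a b iha ihb => simp only [subst, eval, iha, ihb]; rfl
  | rfind' a iha => simp only [subst, eval, iha]; rfl

theorem exists_of_primrec {f : ℕ → ℕ} (hf : Nat.Primrec f) :
    ∃ c : OCode, ∀ n, eval O c n = Part.some (f n) := by
  induction hf with
  | zero => exact ⟨zero, fun n => rfl⟩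
  | succ => exact ⟨succ, fun n => rfl⟩
  | left => exact ⟨left, fun n => rfl⟩
  | right => exact ⟨right, fun n => rfl⟩
  | pair _ _ ihf ihg =>
    obtain ⟨c, hc⟩ := ihf
    obtain ⟨d, hd⟩ := ihg
    exact ⟨pair c d, fun n => eval_pair (hc n) (hd n)⟩
  | comp _ _ ihf ihg =>
    obtain ⟨c, hc⟩ := ihf
    obtain ⟨d, hd⟩ := ihg
    exact ⟨comp c d, fun n => by rw [eval_comp (hd n), hc]⟩
  | @prec f g _ _ ihf ihg =>
    obtain ⟨c, hc⟩ := ihf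
    obtain ⟨d, hd⟩ := ihg
    refine ⟨prec c d, fun n => ?_⟩
    conv_lhs => rw [← Nat.pair_unpair n]
    rw [evalPrec (fun m => Nat.rec (f n.unpair.1)
      (fun y IH => g (Nat.pair n.unpair.1 (Nat.pair y IH))) m) (hc _) (fun y => hd _)]

end OCode

namespace CompIn

variable {α β γ σ : Type*} [Primcodable α] [Primcodable β] [Primcodable γ] [Primcodable σ]
variable {O : Set ℕ}

theorem of_primrec {f : α → β} (hf : Primrec f) : CompIn O f := by
  obtain ⟨c, hc⟩ := OCode.exists_of_primrec (O := chi O) hf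
  obtain ⟨d, hd⟩ := OCode.exists_of_primrec (O := chi O) Nat.Primrec.pred
  refine ⟨d.comp c, fun a => ?_⟩
  rw [OCode.eval_comp (hc _), hd]
  simp

@[fun_prop]
theorem comp {f : β → γ} {g : α → β} (hf : CompIn O f) (hg : CompIn O g) :
    CompIn O (fun a => f (g a)) := by
  obtain ⟨c, hc⟩ := hf
  obtain ⟨d, hd⟩ := hg
  exact ⟨c.comp d, fun a => by rw [OCode.eval_comp (hd a), hc]⟩

@[fun_prop]
theorem id : CompIn O (fun a : α => a) := of_primrec Primrec.id

@[fun_prop]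
theorem const (b : β) : CompIn O (fun _ : α => b) := of_primrec (Primrec.const b)

@[fun_prop]
theorem fst : CompIn O (Prod.fst : α × β → α) := of_primrec Primrec.fst

@[fun_prop]
theorem snd : CompIn O (Prod.snd : α × β → β) := of_primrec Primrec.snd

@[fun_prop]
theorem prodMk {f : α → β} {g : α → γ} (hf : CompIn O f) (hg : CompIn O g) :
    CompIn O (fun a => (f a, g a)) := by
  obtain ⟨c, hc⟩ := hf
  obtain ⟨d, hd⟩ := hg
  exact ⟨c.pair d, fun a => OCode.eval_pair (hc a) (hd a)⟩

theorem primrec₂ {h : β → γ → σ} (hh : Primrec₂ h) {f : α → β} {g : α → γ}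
    (hf : CompIn O f) (hg : CompIn O g) : CompIn O (fun a => h (f a) (g a)) :=
  comp (f := fun p : β × γ => h p.1 p.2) (of_primrec hh) (prodMk hf hg)

theorem congr {f g : α → β} (hf : CompIn O f) (h : ∀ a, g a = f a) : CompIn O g := by
  rwa [funext h]

theorem congr_iff {p q : α → Prop} (hf : CompIn O p) (h : ∀ a, q a ↔ p a) : CompIn O q :=
  hf.congr fun a => propext (h a)

/-! #### Boolean combinations -/

@[fun_prop]
theorem and {p q : α → Prop} (hp : CompIn O p) (hq : CompIn O q) :
    CompIn O (fun a => p a ∧ q a) := by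
  have h : Primrec₂ (fun a b : Prop => a ∧ b) :=
    primrec_prop.1 ((primrec_prop.2 Primrec.fst).and (primrec_prop.2 Primrec.snd))
  exact primrec₂ h hp hq

@[fun_prop]
theorem or {p q : α → Prop} (hp : CompIn O p) (hq : CompIn O q) :
    CompIn O (fun a => p a ∨ q a) := by
  have h : Primrec₂ (fun a b : Prop => a ∨ b) :=
    primrec_prop.1 ((primrec_prop.2 Primrec.fst).or (primrec_prop.2 Primrec.snd))
  exact primrec₂ h hp hq

@[fun_prop]
theorem not {p : α → Prop} (hp : CompIn O p) : CompIn O (fun a => ¬ p a) := by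
  have h : Primrec (fun a : Prop => ¬ a) := primrec_prop.1 ((primrec_prop.2 Primrec.id).not)
  exact comp (of_primrec h) hp

theorem imp {p q : α → Prop} (hp : CompIn O p) (hq : CompIn O q) :
    CompIn O (fun a => p a → q a) :=
  (hp.not.or hq).congr_iff fun _ => imp_iff_not_or

@[fun_prop]
theorem iff {p q : α → Prop} (hp : CompIn O p) (hq : CompIn O q) :
    CompIn O (fun a => p a ↔ q a) :=
  ((hp.imp hq).and (hq.imp hp)).congr_iff fun _ => iff_def

@[fun_prop]
theorem eq {f g : α → β} (hf : CompIn O f) (hg : CompIn O g) :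
    CompIn O (fun a => f a = g a) := by
  have h : Primrec₂ (fun a b : β => a = b) := primrec_prop.1 Primrec.eq
  exact primrec₂ h hf hg

@[fun_prop]
theorem lt {f g : α → ℕ} (hf : CompIn O f) (hg : CompIn O g) :
    CompIn O (fun a => f a < g a) := by
  have h : Primrec₂ (fun a b : ℕ => a < b) := primrec_prop.1 Primrec.nat_lt
  exact primrec₂ h hf hg

/-! #### Basic functions -/

@[fun_prop]
theorem natAdd {f g : α → ℕ} (hf : CompIn O f) (hg : CompIn O g) :
    CompIn O (fun a => f a + g a) := primrec₂ Primrec.nat_add hf hg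

@[fun_prop]
theorem natMul {f g : α → ℕ} (hf : CompIn O f) (hg : CompIn O g) :
    CompIn O (fun a => f a * g a) := primrec₂ Primrec.nat_mul hf hg

@[fun_prop]
theorem natSub {f g : α → ℕ} (hf : CompIn O f) (hg : CompIn O g) :
    CompIn O (fun a => f a - g a) := primrec₂ Primrec.nat_sub hf hg

@[fun_prop]
theorem natPair {f g : α → ℕ} (hf : CompIn O f) (hg : CompIn O g) :
    CompIn O (fun a => Nat.pair (f a) (g a)) := primrec₂ Primrec₂.natPair hf hg

@[fun_prop]
theorem natUnpair {f : α → ℕ} (hf : CompIn O f) : CompIn O (fun a => (f a).unpair) :=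
  comp (of_primrec Primrec.unpair) hf

@[fun_prop]
theorem encode {f : α → β} (hf : CompIn O f) : CompIn O (fun a => Encodable.encode (f a)) :=
  comp (of_primrec Primrec.encode) hf

/-- A total decoding function. -/
def decodeD (β : Type*) [Primcodable β] [Inhabited β] (n : ℕ) : β :=
  (Encodable.decode n).getD default

theorem decodeD_encode [Inhabited β] (b : β) : decodeD β (Encodable.encode b) = b := by
  simp [decodeD]

@[fun_prop]
theorem comp_decodeD [Inhabited β] {f : α → ℕ} (hf : CompIn O f) :
    CompIn O (fun a => decodeD β (f a)) :=
  comp (of_primrec (Primrec.option_getD.comp Primrec.decode (Primrec.const default))) hf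

@[fun_prop]
theorem cons {f : α → β} {g : α → List β} (hf : CompIn O f) (hg : CompIn O g) :
    CompIn O (fun a => f a :: g a) := primrec₂ Primrec.list_cons hf hg

@[fun_prop]
theorem append {f g : α → List β} (hf : CompIn O f) (hg : CompIn O g) :
    CompIn O (fun a => f a ++ g a) := primrec₂ Primrec.list_append hf hg

@[fun_prop]
theorem length {f : α → List β} (hf : CompIn O f) : CompIn O (fun a => (f a).length) :=
  comp (of_primrec Primrec.list_length) hf

@[fun_prop]
theorem getD {f : α → List β} {g : α → ℕ} (d : β) (hf : CompIn O f) (hg : CompIn O g) :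
    CompIn O (fun a => (f a).getD (g a) d) := primrec₂ (Primrec.list_getD d) hf hg

@[fun_prop]
theorem take {f : α → ℕ} {g : α → List β} (hf : CompIn O f) (hg : CompIn O g) :
    CompIn O (fun a => (g a).take (f a)) := primrec₂ Primrec.list_take hf hg

@[fun_prop]
theorem tail {g : α → List β} (hg : CompIn O g) : CompIn O (fun a => (g a).tail) :=
  comp (of_primrec Primrec.list_tail) hg

@[fun_prop]
theorem oracle {f : α → ℕ} (hf : CompIn O f) : CompIn O (fun a => f a ∈ O) := by
  refine comp (f := fun n => n ∈ O) ⟨OCode.oracle, fun n => ?_⟩ hf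
  change chi O n = _
  rw [encode_prop]
  rfl

/-- Multiply out a list indexing: `sel s I` is the tuple of the `s`-entries at indices in `I`. -/
theorem map_getD {f : α → List ℕ} {g : α → List ℕ} (hf : CompIn O f) (hg : CompIn O g) :
    CompIn O (fun a => (g a).map fun i => (f a).getD i 0) := by
  refine primrec₂ (h := fun s I : List ℕ => I.map fun i => s.getD i 0) ?_ hf hg
  refine Primrec.list_map Primrec.snd ?_
  exact (Primrec.list_getD 0).comp (Primrec.fst.comp Primrec.fst) Primrec.snd

/-! #### Search, bounded quantifiers, iteration -/

theorem rfind_eq_some {p : ℕ → Prop} [DecidablePred p] {n : ℕ} (hn : p n)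
    (hm : ∀ m < n, ¬ p m) : (Nat.rfind fun n => Part.some (decide (p n))) = Part.some n := by
  rw [Part.eq_some_iff]
  exact Nat.mem_rfind.2 ⟨by simp [hn], fun {m} h => by simp [hm m h]⟩

theorem nat_find {R : α → ℕ → Prop} (hR : CompIn O (fun p : α × ℕ => R p.1 p.2))
    (h : ∀ a, ∃ n, R a n) :
    ∃ f : α → ℕ, CompIn O f ∧ ∀ a, R a (f a) ∧ ∀ m < f a, ¬ R a m := by
  obtain ⟨c, hc⟩ := hR.not
  refine ⟨fun a => Nat.find (h a), ⟨c.search, fun a => ?_⟩,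
    fun a => ⟨Nat.find_spec (h a), fun m hm => Nat.find_min (h a) hm⟩⟩
  have hc' : ∀ n, OCode.eval (chi O) c (Nat.pair (Encodable.encode a) n) =
      Part.some (if R a n then 0 else 1) := fun n => by
    have := hc (a, n)
    rw [encode_prop] at this
    refine Eq.trans this ?_
    by_cases hr : R a n <;> simp [hr]
  rw [OCode.eval_search _ hc']
  refine rfind_eq_some (p := fun n => (if R a n then 0 else 1) = 0) ?_ ?_
  · simp [Nat.find_spec (h a)]
  · intro m hm
    simp [Nat.find_min (h a) hm]

theorem find [Inhabited β] {R : α → β → Prop} (hR : CompIn O (fun p : α × β => R p.1 p.2))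
    (h : ∀ a, ∃ b, R a b) : ∃ f : α → β, CompIn O f ∧ ∀ a, R a (f a) := by
  have h' : ∀ a, ∃ n, R a (decodeD β n) := fun a => by
    obtain ⟨b, hb⟩ := h a
    exact ⟨Encodable.encode b, by rwa [decodeD_encode]⟩
  have hR' : CompIn O (fun p : α × ℕ => R p.1 (decodeD β p.2)) :=
    comp (f := fun p : α × β => R p.1 p.2) (g := fun p : α × ℕ => (p.1, decodeD β p.2)) hR
      (by fun_prop)
  obtain ⟨f, hf, hf'⟩ := nat_find hR' h'
  exact ⟨_, comp_decodeD hf, fun a => (hf' a).1⟩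

theorem ball_lt {R : α → ℕ → Prop} (hR : CompIn O (fun p : α × ℕ => R p.1 p.2))
    {f : α → ℕ} (hf : CompIn O f) : CompIn O (fun a => ∀ n < f a, R a n) := by
  have h : ∀ a, ∃ n, n = f a ∨ ¬ R a n := fun a => ⟨f a, Or.inl rfl⟩
  have h1 : CompIn O (fun p : α × ℕ => p.2 = f p.1 ∨ ¬ R p.1 p.2) := by
    have : CompIn O (fun p : α × ℕ => f p.1) := hf.comp fst
    exact (snd.eq this).or hR.not
  obtain ⟨g, hg, hg'⟩ := nat_find (R := fun a n => n = f a ∨ ¬ R a n) h1 h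
  refine (hg.eq hf).congr_iff fun a => ?_
  constructor
  · intro ha
    rcases (hg' a).1 with h2 | h2
    · exact h2
    · by_contra h3
      have h4 : ¬ f a < g a := fun h4 => (hg' a).2 _ h4 (Or.inl rfl)
      exact h2 (ha _ (by omega))
  · intro ha n hn
    rw [← ha] at hn
    by_contra hr
    exact (hg' a).2 _ hn (Or.inr hr)

theorem ball_mem {R : α → ℕ → Prop} (hR : CompIn O (fun p : α × ℕ => R p.1 p.2))
    {f : α → List ℕ} (hf : CompIn O f) : CompIn O (fun a => ∀ x ∈ f a, R a x) := by
  have h1 : CompIn O (fun p : α × ℕ => R p.1 ((f p.1).getD p.2 0)) := by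
    have : CompIn O (fun p : α × ℕ => f p.1) := hf.comp fst
    exact comp (f := fun p : α × ℕ => R p.1 p.2) hR (fst.prodMk (this.getD 0 snd))
  refine (ball_lt (R := fun a n => R a ((f a).getD n 0)) h1 hf.length).congr_iff fun a => ?_
  constructor
  · intro h n hn
    rw [List.getD_eq_getElem _ _ hn]
    exact h _ (List.getElem_mem hn)
  · intro h x hx
    obtain ⟨n, hn, rfl⟩ := List.mem_iff_getElem.1 hx
    have := h n hn
    rwa [List.getD_eq_getElem _ _ hn] at this

theorem mem {f : α → ℕ} {g : α → List ℕ} (hf : CompIn O f) (hg : CompIn O g) :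
    CompIn O (fun a => f a ∈ g a) := by
  have h : CompIn O (fun p : α × ℕ => p.2 ≠ f p.1) := by
    have : CompIn O (fun p : α × ℕ => f p.1) := hf.comp fst
    exact (snd.eq this).not
  refine (ball_mem (R := fun a x => x ≠ f a) h hg).not.congr_iff fun a => ?_
  constructor
  · exact fun h1 h2 => h2 _ h1 rfl
  · intro h
    by_contra h1
    exact h fun x hx he => h1 (he ▸ hx)

theorem iterate {f : α → α} (hf : CompIn O f) {n : β → ℕ} {a : β → α} (hn : CompIn O n)
    (ha : CompIn O a) : CompIn O (fun b => f^[n b] (a b)) := by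
  have h : CompIn O (fun p : α × ℕ => f^[p.2] p.1) := by
    obtain ⟨c, hc⟩ := hf
    refine ⟨OCode.prec (OCode.pair OCode.left OCode.right)
      (c.comp (OCode.right.comp OCode.right)), fun p => ?_⟩
    refine OCode.evalPrec (fun n => Encodable.encode (f^[n] p.1)) (OCode.eval_id _) ?_ p.2
    intro y
    have h1 : OCode.eval (chi O) (OCode.right.comp OCode.right)
        (Nat.pair (Encodable.encode (f^[0] p.1)) (Nat.pair y (Encodable.encode (f^[y] p.1)))) =
        Part.some (Encodable.encode (f^[y] p.1)) := by
      rw [OCode.eval_comp (OCode.eval_right _), OCode.eval_right]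
      simp only [Nat.unpair_pair]
    refine (OCode.eval_comp h1).trans ?_
    rw [hc, Function.iterate_succ_apply']
  exact comp h (ha.prodMk hn)

theorem ite {p : α → Prop} {f g : α → β} (hp : CompIn O p) (hf : CompIn O f) (hg : CompIn O g) :
    CompIn O (fun a => if p a then f a else g a) := by
  have h : Primrec (fun x : Prop × β × β => if x.1 then x.2.1 else x.2.2) :=
    Primrec.ite (primrec_prop.2 Primrec.fst) (Primrec.fst.comp Primrec.snd)
      (Primrec.snd.comp Primrec.snd)
  exact comp (of_primrec h) (hp.prodMk (hf.prodMk hg))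

theorem exists_jump [Inhabited β] {R : α → β → Prop}
    (hR : CompIn O (fun p : α × β => R p.1 p.2)) :
    CompIn (jump O) (fun a => ∃ b, R a b) := by
  have hR' : CompIn O (fun p : α × ℕ => R p.1 (decodeD β p.2)) :=
    comp (f := fun p : α × β => R p.1 p.2) (g := fun p : α × ℕ => (p.1, decodeD β p.2)) hR
      (by fun_prop)
  obtain ⟨c, hc⟩ := hR'.not
  have h1 : CompIn (jump O)
      (fun a : α => Nat.pair c.search.encodeCode (Encodable.encode a) ∈ jump O) := by
    fun_prop
  refine h1.congr_iff fun a => ?_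
  have hc' : ∀ n, OCode.eval (chi O) c (Nat.pair (Encodable.encode a) n) =
      Part.some (if R a (decodeD β n) then 0 else 1) := fun n => by
    have := hc (a, n)
    rw [encode_prop] at this
    refine Eq.trans this ?_
    by_cases hr : R a (decodeD β n) <;> simp [hr]
  have h2 : Nat.pair c.search.encodeCode (Encodable.encode a) ∈ jump O ↔
      (OCode.eval (chi O) c.search (Encodable.encode a)).Dom := by
    simp only [jump, Set.mem_ofPred_eq, Nat.unpair_pair]
    constructor
    · rintro ⟨d, hd, h⟩
      rwa [OCode.encodeCode_injective hd] at h
    · exact fun h => ⟨_, rfl, h⟩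
  rw [h2, OCode.eval_search _ hc']
  constructor
  · rintro ⟨b, hb⟩
    have he : ∃ n, R a (decodeD β n) := ⟨Encodable.encode b, by rwa [decodeD_encode]⟩
    rw [rfind_eq_some (p := fun n => (if R a (decodeD β n) then 0 else 1) = 0)
      (n := Nat.find he) (by simp [Nat.find_spec he])
      (fun m hm => by simp [Nat.find_min he hm])]
    trivial
  · intro h
    have := Nat.rfind_spec (Part.get_mem h)
    refine ⟨decodeD β (Part.get _ h), ?_⟩
    simpa using this

theorem forall_jump [Inhabited β] {R : α → β → Prop}
    (hR : CompIn O (fun p : α × β => R p.1 p.2)) :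
    CompIn (jump O) (fun a => ∀ b, R a b) :=
  (exists_jump (R := fun a b => ¬ R a b) hR.not).not.congr_iff fun a => by push Not; rfl

theorem of_oracle {O' : Set ℕ} (h : CompIn O' (fun n => n ∈ O)) {f : α → β} (hf : CompIn O f) :
    CompIn O' f := by
  obtain ⟨d, hd⟩ := h
  obtain ⟨c, hc⟩ := hf
  refine ⟨OCode.subst d c, fun a => ?_⟩
  rw [OCode.eval_subst (O := chi O) ?_, hc]
  funext n
  refine (hd n).trans ?_
  rw [encode_prop]
  rfl

theorem jump {f : α → β} (hf : CompIn O f) : CompIn (jump O) f := by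
  refine of_oracle ?_ hf
  have h : CompIn O (fun p : ℕ × ℕ => p.1 ∈ O) := by fun_prop
  exact (exists_jump (R := fun n (_ : ℕ) => n ∈ O) h).congr_iff fun n => by simp

theorem of_empty {f : α → β} (hf : CompIn ∅ f) : CompIn O f :=
  of_oracle ((const False).congr_iff fun n => by simp) hf

theorem setRecIn_iff {A : Set ℕ} : SetRecIn O A ↔ CompIn O (fun n => n ∈ A) := by
  refine exists_congr fun c => ⟨fun h n => ?_, fun h => funext fun n => ?_⟩
  · rw [h, encode_prop]; rfl
  · refine (h n).trans ?_
    rw [encode_prop]; rfl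

theorem of_ceIn {A : Set ℕ} (h : CEIn O A) : CompIn (CFL.jump O) (fun n => n ∈ A) := by
  obtain ⟨c, hc⟩ := h
  have h1 : CompIn (CFL.jump O) (fun n : ℕ => Nat.pair c.encodeCode n ∈ CFL.jump O) := by fun_prop
  refine h1.congr_iff fun n => ?_
  rw [hc]
  simp only [CFL.jump, Set.mem_ofPred_eq, Nat.unpair_pair]
  constructor
  · exact fun h => ⟨_, rfl, h⟩
  · rintro ⟨d, hd, h⟩
    rwa [OCode.encodeCode_injective hd] at h

theorem ceIn_of_empty {A : Set ℕ} (h : CEIn ∅ A) : CEIn O A := by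
  obtain ⟨c, hc⟩ := h
  obtain ⟨d, hd⟩ := (CompIn.of_empty (O := O) (f := fun n : ℕ => n ∈ (∅ : Set ℕ)) (by fun_prop))
  refine ⟨OCode.subst d c, fun n => ?_⟩
  rw [OCode.eval_subst (O := chi ∅) ?_, hc]
  funext n
  refine (hd n).trans ?_
  rw [encode_prop]
  rfl

end CompIn

/-! ### Closures and embeddings -/

section Structure

variable {A B C : Str L} {s t u v : List ℕ} {f g h : ℕ → ℕ}

theorem InClosure.mono (hst : ∀ x ∈ s, InClosure A t x) {x : ℕ} (hx : InClosure A s x) :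
    InClosure A t x := by
  induction hx with
  | base hx _ => exact hst _ hx
  | fn f as ha _ ih => exact InClosure.fn f as ha ih

theorem InClosure.of_mem (hs : TupleIn A s) : ∀ x ∈ s, InClosure A s x :=
  fun x hx => InClosure.base hx (hs x hx)

theorem inClosure_sub (ht : ∀ x ∈ t, InClosure A s x) {x : ℕ} :
    InClosure (A.sub s) t x ↔ InClosure A t x := by
  constructor
  · intro h
    induction h with
    | base hx _ => exact InClosure.base hx (ht _ hx).mem_dom
    | fn f as ha _ ih => exact InClosure.fn f as ha ih
  · intro h
    induction h with
    | base hx _ => exact InClosure.base hx (ht _ hx)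
    | fn f as ha _ ih => exact InClosure.fn (A := A.sub s) f as ha ih

theorem IsEmbMap.tupleIn (hf : IsEmbMap A B f) (hs : TupleIn A s) : TupleIn B (s.map f) := by
  intro y hy
  obtain ⟨x, hx, rfl⟩ := List.mem_map.1 hy
  exact hf.1 x (hs x hx)

theorem IsEmbMap.comp (hg : IsEmbMap B C g) (hf : IsEmbMap A B f) :
    IsEmbMap A C (fun x => g (f x)) := by
  refine ⟨fun x hx => hg.1 _ (hf.1 x hx), fun x hx y hy h => ?_, fun r as has => ?_,
    fun k as hk has => ?_⟩
  · exact hf.2.1 x hx y hy (hg.2.1 _ (hf.1 x hx) _ (hf.1 y hy) h)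
  · rw [hf.2.2.1 r as has, hg.2.2.1 r _ (hf.tupleIn has), List.map_map]
    rfl
  · dsimp only
    rw [hf.2.2.2 k as hk has, hg.2.2.2 k _ (by simpa using hk) (hf.tupleIn has), List.map_map]
    rfl

theorem isEmbMap_id : IsEmbMap A A (fun x => x) :=
  ⟨fun _ h => h, fun _ _ _ _ h => h, fun _ _ _ => by simp, fun _ _ _ _ => by simp⟩

theorem isEmbMap_sub : IsEmbMap (A.sub s) A (fun x => x) := by
  refine ⟨fun _ h => InClosure.mem_dom h, fun _ _ _ _ h => h, fun r as has => ?_,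
    fun _ _ _ _ => ?_⟩
  · simp only [List.map_id', Str.sub]
    exact and_iff_left has
  · simp [Str.sub]

theorem IsEmbMap.inClosure (hf : IsEmbMap A B f) {x : ℕ} (hx : InClosure A s x) :
    InClosure B (s.map f) (f x) := by
  induction hx with
  | base hx hx' => exact InClosure.base (List.mem_map_of_mem hx) (hf.1 _ hx')
  | fn k as ha has ih =>
    rw [hf.2.2.2 k as ha fun x hx => (has x hx).mem_dom]
    refine InClosure.fn k _ (by simpa using ha) fun y hy => ?_
    obtain ⟨x, hx, rfl⟩ := List.mem_map.1 hy
    exact ih x hx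

theorem exists_list_map {p : ℕ → Prop} {as : List ℕ} (h : ∀ y ∈ as, ∃ x, p x ∧ f x = y) :
    ∃ bs : List ℕ, (∀ x ∈ bs, p x) ∧ bs.map f = as := by
  induction as with
  | nil => exact ⟨[], by simp, rfl⟩
  | cons a as ih =>
    obtain ⟨bs, h1, h2⟩ := ih fun y hy => h y (List.mem_cons_of_mem _ hy)
    obtain ⟨x, hx, rfl⟩ := h a List.mem_cons_self
    exact ⟨x :: bs, by simpa using ⟨hx, h1⟩, by simp [h2]⟩

theorem IsEmbMap.exists_of_inClosure (hf : IsEmbMap A B f) (hs : TupleIn A s) {y : ℕ}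
    (hy : InClosure B (s.map f) y) : ∃ x, InClosure A s x ∧ f x = y := by
  induction hy with
  | base hy _ =>
    obtain ⟨x, hx, rfl⟩ := List.mem_map.1 hy
    exact ⟨x, InClosure.of_mem hs x hx, rfl⟩
  | fn k as ha _ ih =>
    obtain ⟨bs, h1, rfl⟩ := exists_list_map ih
    refine ⟨A.fn k bs, InClosure.fn k bs (by simpa using ha) h1, ?_⟩
    exact hf.2.2.2 k bs (by simpa using ha) fun x hx => (h1 x hx).mem_dom

theorem tupleIn_sub (hs : TupleIn A s) : TupleIn (A.sub s) s := InClosure.of_mem hs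

theorem IsEmbMap.restrict (hf : IsEmbMap A B f) (s : List ℕ) : IsEmbMap (A.sub s) B f :=
  hf.comp isEmbMap_sub

/-- A map into a structure whose range lies in a substructure is an embedding into it. -/
theorem IsEmbMap.codRestrict (hf : IsEmbMap A B f) (h : ∀ x ∈ A.dom, InClosure B t (f x)) :
    IsEmbMap A (B.sub t) f := by
  refine ⟨h, hf.2.1, fun r as has => ?_, hf.2.2.2⟩
  rw [hf.2.2.1 r as has]
  refine (and_iff_left fun y hy => ?_).symm
  obtain ⟨x, hx, rfl⟩ := List.mem_map.1 hy
  exact h x (has x hx)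

theorem IsEmbMap.of_sub (hf : IsEmbMap (A.sub s) B f) (h : ∀ x ∈ A.dom, InClosure A s x) :
    IsEmbMap A B f :=
  hf.comp (isEmbMap_id.codRestrict h)

theorem IsEmbMap.eqOn (hf : IsEmbMap (A.sub s) B f) (hg : IsEmbMap (A.sub s) B g)
    (h : s.map f = s.map g) {x : ℕ} (hx : InClosure A s x) : f x = g x := by
  have h' : ∀ x ∈ s, f x = g x := List.map_inj_left.1 h
  induction hx with
  | base hx _ => exact h' _ hx
  | fn k as ha has ih =>
    have e1 := hf.2.2.2 k as ha has
    have e2 := hg.2.2.2 k as ha has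
    change f (A.fn k as) = _ at e1
    change g (A.fn k as) = _ at e2
    rw [e1, e2, List.map_congr_left ih]

theorem IsIsoMap.comp (hg : IsIsoMap B C g) (hf : IsIsoMap A B f) :
    IsIsoMap A C (fun x => g (f x)) := by
  refine ⟨hg.1.comp hf.1, fun z hz => ?_⟩
  obtain ⟨y, hy, rfl⟩ := hg.2 z hz
  obtain ⟨x, hx, rfl⟩ := hf.2 y hy
  exact ⟨x, hx, rfl⟩

theorem IsIsoMap.exists_inv (hf : IsIsoMap A B f) :
    ∃ g, IsIsoMap B A g ∧ (∀ x ∈ A.dom, g (f x) = x) ∧ ∀ y ∈ B.dom, f (g y) = y := by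
  choose! g hg using hf.2
  have hl : ∀ x ∈ A.dom, g (f x) = x := fun x hx =>
    hf.1.2.1 _ (hg _ (hf.1.1 x hx)).1 _ hx (hg _ (hf.1.1 x hx)).2
  have hm : ∀ as, TupleIn B as → (as.map g).map f = as := fun as has => by
    rw [List.map_map]
    exact (List.map_congr_left fun x hx => (hg x (has x hx)).2).trans (List.map_id _)
  have hmd : ∀ as, TupleIn B as → TupleIn A (as.map g) := fun as has y hy => by
    obtain ⟨x, hx, rfl⟩ := List.mem_map.1 hy
    exact (hg x (has x hx)).1
  refine ⟨g, ⟨⟨fun y hy => (hg y hy).1, fun y hy z hz h => ?_, fun r as has => ?_,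
    fun k as hk has => ?_⟩, fun x hx => ⟨f x, hf.1.1 x hx, hl x hx⟩⟩, hl, fun y hy => (hg y hy).2⟩
  · rw [← (hg y hy).2, ← (hg z hz).2, h]
  · rw [hf.1.2.2.1 r _ (hmd as has), hm as has]
  · have := hf.1.2.2.2 k (as.map g) (by simpa using hk) (hmd as has)
    rw [hm as has] at this
    rw [← this]
    exact hl _ (A.fn_mem k _ (by simpa using hk) (hmd as has))

theorem IsEmbMap.isIsoMap_sub (hf : IsEmbMap (A.sub s) B f) (hs : TupleIn A s) :
    IsIsoMap (A.sub s) (B.sub (s.map f)) f := by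
  refine ⟨hf.codRestrict fun x hx => hf.inClosure ?_, fun y hy => ?_⟩
  · exact (inClosure_sub (InClosure.of_mem hs)).2 hx
  · obtain ⟨x, hx, rfl⟩ := hf.exists_of_inClosure (tupleIn_sub hs) hy
    exact ⟨x, (inClosure_sub (InClosure.of_mem hs)).1 hx, rfl⟩

/-- Two tuples lying in given structures satisfy the same quantifier-free type. -/
def Sim (A : Str L) (s : List ℕ) (B : Str L) (t : List ℕ) : Prop :=
  TupleIn A s ∧ TupleIn B t ∧ ClSim A s B t

theorem Sim.exists_emb (h : Sim A s B t) : ∃ f, s.map f = t ∧ IsEmbMap (A.sub s) B f := by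
  obtain ⟨-, -, f, hf, hi⟩ := h
  exact ⟨f, hf, isEmbMap_sub.comp hi.1⟩

theorem IsEmbMap.sim_of_sub (hf : IsEmbMap (A.sub s) B f)
    (hu : ∀ x ∈ u, InClosure A s x) : Sim A u B (u.map f) := by
  have hu' : TupleIn A u := fun x hx => (hu x hx).mem_dom
  refine ⟨hu', hf.tupleIn hu, f, rfl, IsEmbMap.isIsoMap_sub ?_ hu'⟩
  exact hf.comp (isEmbMap_sub.codRestrict fun x hx => InClosure.mono hu hx)

theorem IsEmbMap.sim (hf : IsEmbMap A B f) (hs : TupleIn A s) : Sim A s B (s.map f) :=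
  (hf.restrict s).sim_of_sub (InClosure.of_mem hs)

theorem Sim.refl (hs : TupleIn A s) : Sim A s A s := by
  simpa using isEmbMap_id.sim hs

theorem Sim.symm (h : Sim A s B t) : Sim B t A s := by
  obtain ⟨hs, ht, f, hf, hi⟩ := h
  obtain ⟨g, hg, hgf, -⟩ := hi.exists_inv
  refine ⟨ht, hs, g, ?_, hg⟩
  rw [← hf, List.map_map]
  exact (List.map_congr_left fun x hx => hgf x (tupleIn_sub hs x hx)).trans (List.map_id _)

theorem Sim.trans (h : Sim A s B t) (h' : Sim B t C u) : Sim A s C u := by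
  obtain ⟨hs, -, f, hf, hi⟩ := h
  obtain ⟨-, hu, g, hg, hj⟩ := h'
  exact ⟨hs, hu, fun x => g (f x), by rw [← hg, ← hf, List.map_map]; rfl, hj.comp hi⟩

theorem Sim.length_eq (h : Sim A s B t) : s.length = t.length := by
  obtain ⟨f, rfl, -⟩ := h.exists_emb
  simp

theorem Sim.right (h : Sim A (s ++ u) B (t ++ v)) (hl : s.length = t.length) : Sim A u B v := by
  obtain ⟨f, hf, he⟩ := h.exists_emb
  rw [List.map_append] at hf
  obtain ⟨-, rfl⟩ := List.append_inj hf (by simpa using hl)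
  exact he.sim_of_sub fun x hx => InClosure.of_mem h.1 x (by simp [hx])

theorem Sim.tupleSim (h : Sim A s B t) : TupleSim s t := by
  obtain ⟨f, hf, -⟩ := h.exists_emb
  obtain ⟨g, hg, -⟩ := h.symm.exists_emb
  exact ⟨f, g, hf, hg⟩

/-- The entries of `s` at the positions `I`. -/
def sel (s I : List ℕ) : List ℕ := I.map fun i => s.getD i 0

theorem sel_map {I : List ℕ} (hI : ∀ i ∈ I, i < s.length) : sel (s.map f) I = (sel s I).map f := by
  simp only [sel, List.map_map]
  refine List.map_congr_left fun i hi => ?_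
  simp [hI i hi]

theorem mem_of_mem_sel {I : List ℕ} (hI : ∀ i ∈ I, i < s.length) {x : ℕ} (hx : x ∈ sel s I) :
    x ∈ s := by
  obtain ⟨i, hi, rfl⟩ := List.mem_map.1 hx
  rw [List.getD_eq_getElem _ _ (hI i hi)]
  exact List.getElem_mem _

theorem exists_sel (h : ∀ x ∈ t, x ∈ s) : ∃ I : List ℕ, (∀ i ∈ I, i < s.length) ∧ sel s I = t := by
  refine exists_list_map (p := fun i => i < s.length) fun x hx => ?_
  obtain ⟨i, hi, rfl⟩ := List.getElem_of_mem (h x hx)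
  exact ⟨i, hi, List.getD_eq_getElem _ _ hi⟩

theorem sel_append {I : List ℕ} (hI : ∀ i ∈ I, i < s.length) : sel (s ++ u) I = sel s I := by
  refine List.map_congr_left fun i hi => ?_
  rw [List.getD_append _ _ _ _ (hI i hi)]

theorem TupleIn.append (hs : TupleIn A s) (ht : TupleIn A t) : TupleIn A (s ++ t) := by
  intro x hx
  rcases List.mem_append.1 hx with h | h
  exacts [hs x h, ht x h]

theorem TupleIn.right (h : TupleIn A (s ++ t)) : TupleIn A t := fun x hx => h x (by simp [hx])

/-! ### Amalgamation bases -/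

theorem AmalgBase.of_iso {𝒞 : Set (Str L)} (h𝒞 : ∀ A ∈ 𝒞, ∀ B, Isom B A → B ∈ 𝒞)
    (hA : AmalgBase 𝒞 A) (hf : IsIsoMap A B f) : AmalgBase 𝒞 B := by
  obtain ⟨g, hg, -, hfg⟩ := hf.exists_inv
  refine ⟨h𝒞 A hA.1 B ⟨g, hg⟩, fun B₀ h₀ B₁ h₁ f₀ f₁ e₀ e₁ => ?_⟩
  obtain ⟨D, hD, g₀, g₁, i₀, i₁, h⟩ := hA.2 B₀ h₀ B₁ h₁ _ _ (e₀.comp hf.1) (e₁.comp hf.1)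
  refine ⟨D, hD, g₀, g₁, i₀, i₁, fun y hy => ?_⟩
  have := h (g y) (hg.1.1 y hy)
  rwa [hfg y hy] at this

theorem Sim.amalgBase_iff {𝒞 : Set (Str L)} (h𝒞 : ∀ A ∈ 𝒞, ∀ B, Isom B A → B ∈ 𝒞)
    (h : Sim A s B t) : AmalgBase 𝒞 (A.sub s) ↔ AmalgBase 𝒞 (B.sub t) := by
  obtain ⟨f, -, hf⟩ := h.2.2
  obtain ⟨g, -, hg⟩ := h.symm.2.2
  exact ⟨fun h => h.of_iso h𝒞 hf, fun h => h.of_iso h𝒞 hg⟩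

end Structure

section Age

variable {K : CompAge L} {A B : Str L} {s t u : List ℕ} {k k₁ k₂ : ℕ}

theorem str_mem_cls (k : ℕ) : K.str k ∈ K.cls :=
  ⟨k, fun x => x, isEmbMap_id, fun x hx => ⟨x, hx, rfl⟩⟩

theorem cls_isom : ∀ A ∈ K.cls, ∀ B, Isom B A → B ∈ K.cls := by
  rintro A ⟨i, g, hg⟩ B ⟨f, hf⟩
  exact ⟨i, _, hg.comp hf⟩

theorem AmalgBase.amalg (hb : AmalgBase K.cls (A.sub s)) (h₁ : Sim A s (K.str k₁) t)
    (h₂ : Sim A s (K.str k₂) u) : ∃ j g₁ g₂, IsEmbMap (K.str k₁) (K.str j) g₁ ∧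
      IsEmbMap (K.str k₂) (K.str j) g₂ ∧ t.map g₁ = u.map g₂ := by
  obtain ⟨f₁, rfl, e₁⟩ := h₁.exists_emb
  obtain ⟨f₂, rfl, e₂⟩ := h₂.exists_emb
  obtain ⟨D, ⟨j, d, hd⟩, g₁, g₂, i₁, i₂, h⟩ :=
    hb.2 _ (str_mem_cls k₁) _ (str_mem_cls k₂) _ _ e₁ e₂
  refine ⟨j, _, _, hd.1.comp i₁, hd.1.comp i₂, ?_⟩
  simp only [List.map_map]
  refine List.map_congr_left fun x hx => ?_
  exact congrArg d (h x (InClosure.of_mem h₁.1 x hx))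

theorem gen_append (x : ℕ) (hx : x ∈ (K.str k).dom) : InClosure (K.str k) (s ++ K.tup k) x :=
  InClosure.mono (fun y hy => InClosure.base (by simp [hy]) (K.tup_mem k y hy)) ((K.gen k x).1 hx)

/-- Amalgamation bases in terms of embedding information. -/
theorem amalgBase_iff (hHP : HP K.cls) (hs : TupleIn (K.str k) s) :
    AmalgBase K.cls ((K.str k).sub s) ↔ ∀ p : (ℕ × List ℕ) × (ℕ × List ℕ),
      Sim (K.str k) s (K.str p.1.1) p.1.2 → Sim (K.str k) s (K.str p.2.1) p.2.2 →
      ∃ q : ℕ × List ℕ × List ℕ × List ℕ, q.2.1.length = s.length ∧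
        Sim (K.str p.1.1) (p.1.2 ++ K.tup p.1.1) (K.str q.1) (q.2.1 ++ q.2.2.1) ∧
        Sim (K.str p.2.1) (p.2.2 ++ K.tup p.2.1) (K.str q.1) (q.2.1 ++ q.2.2.2) := by
  constructor
  · rintro hb ⟨⟨k₁, t⟩, ⟨k₂, u⟩⟩ h₁ h₂
    obtain ⟨j, g₁, g₂, i₁, i₂, h⟩ := hb.amalg h₁ h₂
    refine ⟨⟨j, t.map g₁, (K.tup k₁).map g₁, (K.tup k₂).map g₂⟩, by simp [h₁.length_eq], ?_, ?_⟩
    · have := i₁.sim (h₁.2.1.append (K.tup_mem k₁))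
      rwa [List.map_append] at this
    · have := i₂.sim (h₂.2.1.append (K.tup_mem k₂))
      rwa [List.map_append, ← h] at this
  · intro h
    refine ⟨hHP _ (str_mem_cls k) s hs, ?_⟩
    rintro B₀ ⟨k₁, c₁, hc₁⟩ B₁ ⟨k₂, c₂, hc₂⟩ f₀ f₁ e₀ e₁
    have d₀ := hc₁.1.comp e₀
    have d₁ := hc₂.1.comp e₁
    have s₀ := d₀.sim_of_sub (InClosure.of_mem hs)
    have s₁ := d₁.sim_of_sub (InClosure.of_mem hs)
    obtain ⟨⟨j, e, a, b⟩, hl, i₀, i₁⟩ := h ((k₁, _), (k₂, _)) s₀ s₁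
    dsimp only at hl i₀ i₁
    obtain ⟨g₀, hg₀, m₀⟩ := i₀.exists_emb
    obtain ⟨g₁, hg₁, m₁⟩ := i₁.exists_emb
    rw [List.map_append] at hg₀ hg₁
    have n₀ := (List.append_inj hg₀ (by simp [hl])).1
    have n₁ := (List.append_inj hg₁ (by simp [hl])).1
    have o₀ := m₀.of_sub gen_append
    have o₁ := m₁.of_sub gen_append
    refine ⟨K.str j, str_mem_cls j, _, _, o₀.comp hc₁.1, o₁.comp hc₂.1, fun x hx => ?_⟩
    refine IsEmbMap.eqOn (o₀.comp d₀) (o₁.comp d₁) ?_ hx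
    rw [List.map_map] at n₀ n₁
    exact n₀.trans n₁.symm

end Age

/-! ### Effectivity of the basic relations -/

/-- The hypotheses on the age collected in a class. -/
class FraisseAge (K : CompAge L) : Prop where
  computable : AgeComputableIn ∅ K
  hereditary : HP K.cls
  joint : JEP K.cls
  cofinal : CoAP K.cls

/-- The double jump of the embedding information. -/
def CompAge.orc (K : CompAge L) : Set ℕ := jump (jump (EmbedInfo K))

/-- `Sim` between members of an enumerated age. -/
def EI (K : CompAge L) (k : ℕ) (s : List ℕ) (l : ℕ) (t : List ℕ) : Prop :=
  Sim (K.str k) s (K.str l) t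

/-- The tuple `s` generates an amalgamation base. -/
def Base (K : CompAge L) (k : ℕ) (s : List ℕ) : Prop :=
  TupleIn (K.str k) s ∧ AmalgBase K.cls ((K.str k).sub s)

section Effective

variable {K : CompAge L} {α : Type*} [Primcodable α]

theorem mem_embedInfo_iff {k l : ℕ} {s t : List ℕ} :
    Nat.pair k (Nat.pair (Encodable.encode s) (Nat.pair l (Encodable.encode t))) ∈ EmbedInfo K ↔
      EI K k s l t := by
  constructor
  · rintro ⟨k', s', l', t', h1, h2, h3, h⟩
    simp only [Nat.pair_eq_pair, Encodable.encode_inj] at h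
    obtain ⟨rfl, rfl, rfl, rfl⟩ := h
    exact ⟨h1, h2, h3⟩
  · rintro ⟨h1, h2, h3⟩
    exact ⟨_, _, _, _, h1, h2, h3, rfl⟩

@[fun_prop]
theorem compIn_EI₀ {k l : α → ℕ} {s t : α → List ℕ} (hk : CompIn (EmbedInfo K) k)
    (hs : CompIn (EmbedInfo K) s) (hl : CompIn (EmbedInfo K) l) (ht : CompIn (EmbedInfo K) t) :
    CompIn (EmbedInfo K) (fun a => EI K (k a) (s a) (l a) (t a)) := by
  have h : CompIn (EmbedInfo K) (fun a => Nat.pair (k a) (Nat.pair (Encodable.encode (s a))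
    (Nat.pair (l a) (Encodable.encode (t a)))) ∈ EmbedInfo K) := by fun_prop
  exact h.congr_iff fun a => mem_embedInfo_iff.symm

@[fun_prop]
theorem compIn_EI₁ {k l : α → ℕ} {s t : α → List ℕ} (hk : CompIn (jump (EmbedInfo K)) k)
    (hs : CompIn (jump (EmbedInfo K)) s) (hl : CompIn (jump (EmbedInfo K)) l)
    (ht : CompIn (jump (EmbedInfo K)) t) :
    CompIn (jump (EmbedInfo K)) (fun a => EI K (k a) (s a) (l a) (t a)) := by
  have h : CompIn (EmbedInfo K) (fun p : ℕ × List ℕ × ℕ × List ℕ =>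
    EI K p.1 p.2.1 p.2.2.1 p.2.2.2) := by fun_prop
  exact CompIn.comp (g := fun a => (k a, s a, l a, t a)) h.jump (by fun_prop)

@[fun_prop]
theorem compIn_EI {k l : α → ℕ} {s t : α → List ℕ} (hk : CompIn K.orc k)
    (hs : CompIn K.orc s) (hl : CompIn K.orc l) (ht : CompIn K.orc t) :
    CompIn K.orc (fun a => EI K (k a) (s a) (l a) (t a)) := by
  have h : CompIn (jump (EmbedInfo K)) (fun p : ℕ × List ℕ × ℕ × List ℕ =>
    EI K p.1 p.2.1 p.2.2.1 p.2.2.2) := by fun_prop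
  exact CompIn.comp (g := fun a => (k a, s a, l a, t a)) h.jump (by fun_prop)

theorem EI_self {k : ℕ} {s : List ℕ} : EI K k s k s ↔ TupleIn (K.str k) s :=
  ⟨fun h => h.1, Sim.refl⟩

theorem EI_self_singleton {k x : ℕ} : EI K k [x] k [x] ↔ x ∈ (K.str k).dom := by
  simp [EI_self, TupleIn]

theorem CompIn.of_jump {f : α → β} [Primcodable β] (h : CompIn (CFL.jump (EmbedInfo K)) f) :
    CompIn K.orc f := h.jump

variable [hK : FraisseAge K]

theorem compIn_diag₁ : CompIn (jump (EmbedInfo K)) (fun n => n ∈ K.diag) :=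
  CompIn.of_ceIn (CompIn.ceIn_of_empty hK.computable.1)

@[fun_prop]
theorem compIn_diag {f : α → ℕ} (hf : CompIn K.orc f) : CompIn K.orc (fun a => f a ∈ K.diag) :=
  CompIn.comp compIn_diag₁.of_jump hf

omit hK in
theorem mem_diag_zero {k : ℕ} {s : List ℕ} :
    Nat.pair 0 (Nat.pair k (Encodable.encode s)) ∈ K.diag ↔ s = K.tup k := by
  simp only [CompAge.diag, Set.mem_union, Set.mem_ofPred_eq, Nat.pair_eq_pair]
  simp

omit hK in
theorem mem_diag_two {k r : ℕ} {s : List ℕ} :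
    Nat.pair 2 (Nat.pair k (Nat.pair r (Encodable.encode s))) ∈ K.diag ↔
      TupleIn (K.str k) s ∧ (K.str k).rel r s := by
  simp only [CompAge.diag, Set.mem_union, Set.mem_ofPred_eq, Nat.pair_eq_pair]
  constructor
  · simp +contextual
  · rintro ⟨h1, h2⟩
    exact Or.inl (Or.inl (Or.inr ⟨k, r, s, h1, h2, by simp⟩))

omit hK in
theorem mem_diag_four {k f b : ℕ} {s : List ℕ} :
    Nat.pair 4 (Nat.pair k (Nat.pair f (Nat.pair (Encodable.encode s) b))) ∈ K.diag ↔
      TupleIn (K.str k) s ∧ L.funArity f = some s.length ∧ (K.str k).fn f s = b := by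
  simp only [CompAge.diag, Set.mem_union, Set.mem_ofPred_eq, Nat.pair_eq_pair]
  constructor
  · simp +contextual
  · rintro ⟨h1, h2, h3⟩
    exact Or.inr ⟨k, f, s, b, h1, h2, h3, by simp⟩

theorem compIn_tup₁ : CompIn (jump (EmbedInfo K)) K.tup := by
  have h := CompIn.comp
    (g := fun p : ℕ × List ℕ => Nat.pair 0 (Nat.pair p.1 (Encodable.encode p.2)))
    (compIn_diag₁ (K := K)) (by fun_prop)
  obtain ⟨f, hf, hf'⟩ := CompIn.find
    (R := fun k s => Nat.pair 0 (Nat.pair k (Encodable.encode s)) ∈ K.diag) h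
    (fun k => ⟨K.tup k, mem_diag_zero.2 rfl⟩)
  exact hf.congr fun k => (mem_diag_zero.1 (hf' k)).symm

@[fun_prop]
theorem compIn_tup {f : α → ℕ} (hf : CompIn K.orc f) : CompIn K.orc (fun a => K.tup (f a)) :=
  CompIn.comp compIn_tup₁.of_jump hf

@[fun_prop]
theorem compIn_Base {k : α → ℕ} {s : α → List ℕ} (hk : CompIn K.orc k) (hs : CompIn K.orc s) :
    CompIn K.orc (fun a => Base K (k a) (s a)) := by
  have h1 : CompIn (jump (EmbedInfo K))
      (fun p : List ℕ × ((ℕ × List ℕ × List ℕ) × (ℕ × List ℕ × List ℕ)) =>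
      ∃ q : ℕ × List ℕ × List ℕ × List ℕ, q.2.1.length = p.1.length ∧
        EI K p.2.1.1 (p.2.1.2.1 ++ p.2.1.2.2) q.1 (q.2.1 ++ q.2.2.1) ∧
        EI K p.2.2.1 (p.2.2.2.1 ++ p.2.2.2.2) q.1 (q.2.1 ++ q.2.2.2)) :=
    CompIn.exists_jump (R := fun (p : List ℕ × ((ℕ × List ℕ × List ℕ) × (ℕ × List ℕ × List ℕ)))
      (q : ℕ × List ℕ × List ℕ × List ℕ) => q.2.1.length = p.1.length ∧
        EI K p.2.1.1 (p.2.1.2.1 ++ p.2.1.2.2) q.1 (q.2.1 ++ q.2.2.1) ∧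
        EI K p.2.2.1 (p.2.2.2.1 ++ p.2.2.2.2) q.1 (q.2.1 ++ q.2.2.2)) (by fun_prop)
  have ht {f : (ℕ × List ℕ) × ((ℕ × List ℕ × List ℕ) × (ℕ × List ℕ × List ℕ)) → ℕ}
      (hf : CompIn (jump (EmbedInfo K)) f) :
    CompIn (jump (EmbedInfo K)) (fun a => K.tup (f a)) := CompIn.comp compIn_tup₁ hf
  have h2 := h1.comp (g := fun p : (ℕ × List ℕ) × ((ℕ × List ℕ × List ℕ) × (ℕ × List ℕ × List ℕ)) =>
    (p.1.2, p.2)) (by fun_prop)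
  have h3 : CompIn K.orc (fun a : ℕ × List ℕ => ∀ p : (ℕ × List ℕ × List ℕ) × (ℕ × List ℕ × List ℕ),
      EI K a.1 a.2 p.1.1 p.1.2.1 → EI K a.1 a.2 p.2.1 p.2.2.1 → p.1.2.2 = K.tup p.1.1 →
      p.2.2.2 = K.tup p.2.1 →
      ∃ q : ℕ × List ℕ × List ℕ × List ℕ, q.2.1.length = a.2.length ∧
        EI K p.1.1 (p.1.2.1 ++ p.1.2.2) q.1 (q.2.1 ++ q.2.2.1) ∧
        EI K p.2.1 (p.2.2.1 ++ p.2.2.2) q.1 (q.2.1 ++ q.2.2.2)) := by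
    refine CompIn.forall_jump ?_
    refine CompIn.imp (by fun_prop) (CompIn.imp (by fun_prop) (CompIn.imp ?_ (CompIn.imp ?_ h2)))
    · exact CompIn.eq (by fun_prop) (ht (by fun_prop))
    · exact CompIn.eq (by fun_prop) (ht (by fun_prop))
  have h4 : CompIn K.orc (fun a : ℕ × List ℕ => Base K a.1 a.2) := by
    refine (CompIn.and (p := fun a : ℕ × List ℕ => EI K a.1 a.2 a.1 a.2) (by fun_prop) h3).congr_iff
      fun a => ?_
    rw [Base, EI_self]
    refine and_congr_right fun ha => ?_
    rw [amalgBase_iff hK.hereditary ha]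
    constructor
    · rintro h ⟨⟨k₁, t₁, u₁⟩, k₂, t₂, u₂⟩ i₁ i₂ e₁ e₂
      dsimp only at e₁ e₂
      subst e₁ e₂
      exact h ((k₁, t₁), k₂, t₂) i₁ i₂
    · rintro h ⟨⟨k₁, t₁⟩, k₂, t₂⟩ i₁ i₂
      exact h ((k₁, t₁, K.tup k₁), k₂, t₂, K.tup k₂) i₁ i₂ rfl rfl
  exact CompIn.comp (g := fun a => (k a, s a)) h4 (by fun_prop)

end Effective

/-! ### The chain of amalgamation bases -/

section Chain

variable {K : CompAge L}

/-- A pair of an index and a tuple generating the structure of that index. -/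
def Valid (K : CompAge L) (σ : ℕ × List ℕ) : Prop :=
  TupleIn (K.str σ.1) σ.2 ∧ ∀ x ∈ K.tup σ.1, x ∈ σ.2

theorem Valid.inClosure {σ : ℕ × List ℕ} (h : Valid K σ) {x : ℕ} (hx : x ∈ (K.str σ.1).dom) :
    InClosure (K.str σ.1) σ.2 x :=
  InClosure.mono (fun y hy => InClosure.of_mem h.1 y (h.2 y hy)) ((K.gen σ.1 x).1 hx)

/-- An extension task: the positions of an amalgamation base, and an extension of it, given by an
index, the image of the base, and a tuple. -/
abbrev Task : Type := List ℕ × ℕ × List ℕ × List ℕ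

/-- The task `q` is meaningful for the state `σ`. -/
def Applicable (K : CompAge L) (σ : ℕ × List ℕ) (q : Task) : Prop :=
  (∀ i ∈ q.1, i < σ.2.length) ∧ Base K σ.1 (sel σ.2 q.1) ∧
    EI K σ.1 (sel σ.2 q.1) q.2.1 q.2.2.1 ∧ TupleIn (K.str q.2.1) q.2.2.2

/-- The state `τ` extends `σ`, is a base, and performs the task `q` by means of the tuple `d`. -/
def Step (K : CompAge L) (σ : ℕ × List ℕ) (q : Task) (τ : ℕ × List ℕ) (d : List ℕ) : Prop :=
  Valid K τ ∧ EI K σ.1 σ.2 τ.1 (τ.2.take σ.2.length) ∧ Base K τ.1 τ.2 ∧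
    (Applicable K σ q → (∀ x ∈ d, x ∈ τ.2) ∧
      EI K q.2.1 (q.2.2.1 ++ q.2.2.2) τ.1 (sel τ.2 q.1 ++ d))

theorem exists_base [hK : FraisseAge K] (j : ℕ) : ∃ k h, IsEmbMap (K.str j) (K.str k) h ∧
    AmalgBase K.cls (K.str k) := by
  obtain ⟨A, hA, g, hg⟩ := hK.cofinal _ (str_mem_cls j)
  obtain ⟨⟨k, h, hh⟩, -⟩ := id hA
  exact ⟨k, _, hh.1.comp hg, hA.of_iso cls_isom hh⟩

theorem AmalgBase.base {k : ℕ} {s : List ℕ} (h : AmalgBase K.cls (K.str k))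
    (hs : TupleIn (K.str k) s) (hs' : ∀ x ∈ (K.str k).dom, InClosure (K.str k) s x) :
    Base K k s :=
  ⟨hs, h.of_iso cls_isom (f := fun x => x)
    ⟨isEmbMap_id.codRestrict hs', fun x hx => ⟨x, InClosure.mem_dom hx, rfl⟩⟩⟩

theorem Base.amalgBase {σ : ℕ × List ℕ} (h : Base K σ.1 σ.2) (hσ : Valid K σ) :
    AmalgBase K.cls (K.str σ.1) :=
  h.2.of_iso cls_isom (f := fun x => x)
    ⟨isEmbMap_sub, fun x hx => ⟨x, hσ.inClosure hx, rfl⟩⟩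

theorem exists_step [hK : FraisseAge K] {σ : ℕ × List ℕ} (hσ : Valid K σ) (q : Task) :
    ∃ τ d, Step K σ q τ d := by
  obtain ⟨I, l, c, t⟩ := q
  have h : ∃ j g d, IsEmbMap (K.str σ.1) (K.str j) g ∧ TupleIn (K.str j) d ∧
      (Applicable K σ (I, l, c, t) →
        Sim (K.str l) (c ++ t) (K.str j) ((sel σ.2 I).map g ++ d)) := by
    by_cases ha : Applicable K σ (I, l, c, t)
    · obtain ⟨-, hb, hc, ht⟩ := ha
      obtain ⟨j, g₁, g₂, i₁, i₂, e⟩ := hb.2.amalg (Sim.refl hb.1) hc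
      refine ⟨j, g₁, t.map g₂, i₁, i₂.tupleIn ht, fun _ => ?_⟩
      have := i₂.sim (hc.2.1.append ht)
      rwa [List.map_append, ← e] at this
    · exact ⟨σ.1, fun x => x, [], isEmbMap_id, by simp [TupleIn], fun h => absurd h ha⟩
  obtain ⟨j, g, d, hg, hd, ha⟩ := h
  obtain ⟨k, h, hh, hk⟩ := exists_base (K := K) j
  have hgh := hh.comp hg
  have hv : Valid K (k, σ.2.map (fun x => h (g x)) ++ (d.map h ++ K.tup k)) :=
    ⟨(hgh.tupleIn hσ.1).append ((hh.tupleIn hd).append (K.tup_mem k)), fun x hx => by simp [hx]⟩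
  refine ⟨_, d.map h, hv, ?_, hk.base hv.1 fun x => hv.inClosure, fun ha' => ⟨fun x hx => ?_, ?_⟩⟩
  · have := hgh.sim hσ.1
    rw [EI]
    simpa [List.take_append] using this
  · simp only [List.mem_append]
    exact Or.inr (Or.inl hx)
  · dsimp only
    rw [sel_append (by simpa using ha'.1), sel_map ha'.1]
    refine (ha ha').trans ?_
    have := hh.sim (ha ha').2.1
    simpa [List.map_append, List.map_map, Function.comp_def] using this

/-- A computable chain of members of the age performing all tasks infinitely often. -/
structure Chain (K : CompAge L) where
  k : ℕ → ℕ
  s : ℕ → List ℕ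
  valid : ∀ n, Valid K (k n, s n)
  emb : ∀ n, EI K (k n) (s n) (k (n + 1)) ((s (n + 1)).take (s n).length)
  base : ∀ n, 0 < n → Base K (k n) (s n)
  task : ∀ n, Applicable K (k n, s n) (CompIn.decodeD Task n.unpair.1) →
    ∃ d, (∀ x ∈ d, x ∈ s (n + 1)) ∧ EI K (CompIn.decodeD Task n.unpair.1).2.1
      ((CompIn.decodeD Task n.unpair.1).2.2.1 ++ (CompIn.decodeD Task n.unpair.1).2.2.2) (k (n + 1))
      (sel (s (n + 1)) (CompIn.decodeD Task n.unpair.1).1 ++ d)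
  compIn_k : CompIn K.orc k
  compIn_s : CompIn K.orc s

theorem exists_chain (K : CompAge L) [hK : FraisseAge K] : Nonempty (Chain K) := by
  have hv : CompIn K.orc (fun σ : ℕ × List ℕ => Valid K σ) := by
    have h1 : CompIn K.orc (fun σ : ℕ × List ℕ => EI K σ.1 σ.2 σ.1 σ.2) := by fun_prop
    have h2 : CompIn K.orc (fun σ : ℕ × List ℕ => ∀ x ∈ K.tup σ.1, x ∈ σ.2) :=
      CompIn.ball_mem (R := fun (σ : ℕ × List ℕ) x => x ∈ σ.2)
        (CompIn.mem (by fun_prop) (by fun_prop)) (by fun_prop)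
    exact (h1.and h2).congr_iff fun σ => by rw [EI_self, Valid]
  have hsel {α : Type} [Primcodable α] {f g : α → List ℕ} (hf : CompIn K.orc f)
    (hg : CompIn K.orc g) : CompIn K.orc (fun a => sel (f a) (g a)) := CompIn.map_getD hf hg
  have happ : CompIn K.orc (fun p : (ℕ × List ℕ) × Task => Applicable K p.1 p.2) := by
    have h1 : CompIn K.orc (fun p : (ℕ × List ℕ) × Task => ∀ i ∈ p.2.1, i < p.1.2.length) :=
      CompIn.ball_mem (R := fun (p : (ℕ × List ℕ) × Task) i => i < p.1.2.length) (by fun_prop)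
        (by fun_prop)
    have h2 : CompIn K.orc (fun p : (ℕ × List ℕ) × Task => sel p.1.2 p.2.1) :=
      hsel (by fun_prop) (by fun_prop)
    have h3 : CompIn K.orc (fun p : (ℕ × List ℕ) × Task => Base K p.1.1 (sel p.1.2 p.2.1) ∧
        EI K p.1.1 (sel p.1.2 p.2.1) p.2.2.1 p.2.2.2.1 ∧
        EI K p.2.2.1 p.2.2.2.2 p.2.2.1 p.2.2.2.2) := by fun_prop
    exact (h1.and h3).congr_iff fun p => by rw [EI_self, Applicable]
  have hstep : CompIn K.orc (fun p : ((ℕ × List ℕ) × Task) × ((ℕ × List ℕ) × List ℕ) =>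
      Valid K p.1.1 → Step K p.1.1 p.1.2 p.2.1 p.2.2) := by
    refine CompIn.imp (hv.comp (by fun_prop)) ?_
    unfold Step
    refine CompIn.and (hv.comp (by fun_prop)) (CompIn.and (by fun_prop) (CompIn.and (by fun_prop)
      (CompIn.imp (happ.comp (by fun_prop)) (CompIn.and ?_ ?_))))
    · exact CompIn.ball_mem
        (R := fun (p : ((ℕ × List ℕ) × Task) × ((ℕ × List ℕ) × List ℕ)) x => x ∈ p.2.1.2)
        (CompIn.mem (by fun_prop) (by fun_prop)) (by fun_prop)
    · have : CompIn K.orc (fun p : ((ℕ × List ℕ) × Task) × ((ℕ × List ℕ) × List ℕ) =>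
        sel p.2.1.2 p.1.2.1) := hsel (by fun_prop) (by fun_prop)
      fun_prop
  obtain ⟨F, hF, hF'⟩ := CompIn.find (R := fun (p : (ℕ × List ℕ) × Task)
    (r : (ℕ × List ℕ) × List ℕ) => Valid K p.1 → Step K p.1 p.2 r.1 r.2) hstep (fun p => by
      by_cases h : Valid K p.1
      · obtain ⟨τ, d, h'⟩ := exists_step h p.2
        exact ⟨(τ, d), fun _ => h'⟩
      · exact ⟨default, fun hn => absurd hn h⟩)
  set G : ℕ × ℕ × List ℕ → ℕ × ℕ × List ℕ := fun p =>
    (p.1 + 1, (F (p.2, CompIn.decodeD Task p.1.unpair.1)).1) with hG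
  have hGc : CompIn K.orc G := by
    have : CompIn K.orc (fun p : ℕ × ℕ × List ℕ => F (p.2, CompIn.decodeD Task p.1.unpair.1)) :=
      hF.comp (by fun_prop)
    fun_prop
  set S : ℕ → ℕ × ℕ × List ℕ := fun n => G^[n] (0, 0, K.tup 0) with hS
  have hSc : CompIn K.orc S := CompIn.iterate hGc (by fun_prop) (by fun_prop)
  have hSs : ∀ n, S (n + 1) = G (S n) := fun n => Function.iterate_succ_apply' _ _ _
  have hS1 : ∀ n, (S n).1 = n := by
    intro n
    induction n with
    | zero => rfl
    | succ n ih => rw [hSs, hG]; simp [ih]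
  have hSt : ∀ n, Valid K (S n).2 → Step K (S n).2 (CompIn.decodeD Task n.unpair.1) (S (n + 1)).2
      (F ((S n).2, CompIn.decodeD Task n.unpair.1)).2 := by
    intro n h
    have := hF' ((S n).2, CompIn.decodeD Task n.unpair.1) h
    rw [hSs, hG]
    simp only [hS1]
    exact this
  have hSv : ∀ n, Valid K (S n).2 := by
    intro n
    induction n with
    | zero => exact ⟨K.tup_mem 0, fun x hx => hx⟩
    | succ n ih => exact (hSt n ih).1
  refine ⟨⟨fun n => (S n).2.1, fun n => (S n).2.2, hSv, fun n => (hSt n (hSv n)).2.1,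
    fun n hn => ?_, fun n ha => ⟨_, (hSt n (hSv n)).2.2.2 ha⟩, by fun_prop, by fun_prop⟩⟩
  obtain ⟨m, rfl⟩ : ∃ m, n = m + 1 := ⟨n - 1, by omega⟩
  exact (hSt m (hSv m)).2.2.1

end Chain

/-! ### Limits of chains of embeddings -/

theorem eq_of_map_eq {f : ℕ → ℕ} {S : Set ℕ} (hf : ∀ x ∈ S, ∀ y ∈ S, f x = f y → x = y) :
    ∀ {u v : List ℕ}, (∀ x ∈ u, x ∈ S) → (∀ x ∈ v, x ∈ S) → u.map f = v.map f → u = v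
  | [], [], _, _, _ => rfl
  | [], b :: v, _, _, h => by simp at h
  | a :: u, [], _, _, h => by simp at h
  | a :: u, b :: v, hu, hv, h => by
    simp only [List.map_cons, List.cons.injEq] at h
    rw [hf a (hu a (by simp)) b (hv b (by simp)) h.1,
      eq_of_map_eq hf (fun x hx => hu x (by simp [hx])) (fun x hx => hv x (by simp [hx])) h.2]

/-- A chain of embeddings together with compatible injections into `ℕ`. -/
structure DirectedChain (L : Lang) where
  A : ℕ → Str L
  f : ℕ → ℕ → ℕ
  emb : ∀ n, IsEmbMap (A n) (A (n + 1)) (f n)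
  e : ℕ → ℕ → ℕ
  inj : ∀ n, ∀ x ∈ (A n).dom, ∀ y ∈ (A n).dom, e n x = e n y → x = y
  compat : ∀ n, ∀ x ∈ (A n).dom, e (n + 1) (f n x) = e n x

namespace DirectedChain

variable (c : DirectedChain L)

theorem exists_map {n m : ℕ} (h : n ≤ m) :
    ∃ g, IsEmbMap (c.A n) (c.A m) g ∧ ∀ x ∈ (c.A n).dom, c.e m (g x) = c.e n x := by
  induction m, h using Nat.le_induction with
  | base => exact ⟨_, isEmbMap_id, fun _ _ => rfl⟩
  | succ m _ ih =>
    obtain ⟨g, hg, he⟩ := ih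
    exact ⟨_, (c.emb m).comp hg, fun x hx => by rw [c.compat m _ (hg.1 x hx), he x hx]⟩

theorem lift_le {n m : ℕ} (h : n ≤ m) {u : List ℕ} (hu : TupleIn (c.A n) u) :
    ∃ v, v.map (c.e m) = u.map (c.e n) ∧ Sim (c.A n) u (c.A m) v := by
  obtain ⟨g, hg, he⟩ := c.exists_map h
  refine ⟨u.map g, ?_, hg.sim hu⟩
  rw [List.map_map]
  exact List.map_congr_left fun x hx => he x (hu x hx)

theorem exists_lift_of_forall {as : List ℕ} (h : ∀ y ∈ as, ∃ n, ∃ x ∈ (c.A n).dom, c.e n x = y) :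
    ∃ N, ∀ n, N ≤ n → ∃ u, TupleIn (c.A n) u ∧ u.map (c.e n) = as := by
  induction as with
  | nil => exact ⟨0, fun n _ => ⟨[], by simp [TupleIn], rfl⟩⟩
  | cons a as ih =>
    obtain ⟨N, hN⟩ := ih fun y hy => h y (List.mem_cons_of_mem _ hy)
    obtain ⟨m, x, hx, rfl⟩ := h a List.mem_cons_self
    refine ⟨max N m, fun n hn => ?_⟩
    obtain ⟨u, hu, rfl⟩ := hN n (by omega)
    obtain ⟨g, hg, he⟩ := c.exists_map (n := m) (m := n) (by omega)
    refine ⟨g x :: u, fun y hy => ?_, by simp [he x hx]⟩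
    rcases List.mem_cons.1 hy with rfl | hy
    exacts [hg.1 x hx, hu y hy]

/-- Two lifts of the same tuple look the same. -/
theorem lift_sim {n m : ℕ} {u v : List ℕ} (hu : TupleIn (c.A n) u) (hv : TupleIn (c.A m) v)
    (h : u.map (c.e n) = v.map (c.e m)) : Sim (c.A n) u (c.A m) v := by
  obtain ⟨u', h1, h2⟩ := c.lift_le (le_max_left n m) hu
  obtain ⟨v', h3, h4⟩ := c.lift_le (le_max_right n m) hv
  have : u' = v' := eq_of_map_eq (c.inj (max n m)) h2.2.1 h4.2.1 (by rw [h1, h3, h])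
  rw [this] at h2
  exact h2.trans h4.symm

theorem lift_fn {n m : ℕ} {u v : List ℕ} (hu : TupleIn (c.A n) u) (hv : TupleIn (c.A m) v)
    (h : u.map (c.e n) = v.map (c.e m)) {k : ℕ} (hk : L.funArity k = some u.length) :
    c.e n ((c.A n).fn k u) = c.e m ((c.A m).fn k v) := by
  obtain ⟨g, hg, hg'⟩ := c.exists_map (le_max_left n m)
  obtain ⟨g₂, hg₂, hg₂'⟩ := c.exists_map (le_max_right n m)
  have hl : u.length = v.length := by simpa using congrArg List.length h
  have : u.map g = v.map g₂ := by
    refine eq_of_map_eq (c.inj (max n m)) (hg.tupleIn hu) (hg₂.tupleIn hv) ?_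
    rw [List.map_map, List.map_map]
    refine Eq.trans ?_ (h.trans ?_)
    · exact List.map_congr_left fun x hx => hg' x (hu x hx)
    · exact List.map_congr_left fun x hx => (hg₂' x (hv x hx)).symm
  rw [← hg' _ ((c.A n).fn_mem k u hk hu), hg.2.2.2 k u hk hu, this,
    ← hg₂.2.2.2 k v (by rw [hk, hl]) hv, hg₂' _ ((c.A m).fn_mem k v (by rw [hk, hl]) hv)]

/-- The tuple `as` together with a lift to a stage of the chain. -/
def IsLift (as : List ℕ) (p : ℕ × List ℕ) : Prop :=
  TupleIn (c.A p.1) p.2 ∧ p.2.map (c.e p.1) = as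

variable {c} in
theorem IsLift.length_eq {as : List ℕ} {p : ℕ × List ℕ} (h : c.IsLift as p) :
    p.2.length = as.length := by
  rw [← h.2, List.length_map]

/-- The union of the chain, realized on `ℕ`. -/
noncomputable def limit : Str L where
  dom := {y | ∃ n, ∃ x ∈ (c.A n).dom, c.e n x = y}
  rel r as := ∃ p, c.IsLift as p ∧ (c.A p.1).rel r p.2
  fn k as := if h : L.funArity k = some as.length ∧ ∃ p, c.IsLift as p then
      c.e h.2.choose.1 ((c.A h.2.choose.1).fn k h.2.choose.2)
    else 0
  rel_valid := by
    rintro r as ⟨⟨n, u⟩, ⟨hu, rfl⟩, h⟩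
    refine ⟨by simpa using ((c.A n).rel_valid r u h).1, fun y hy => ?_⟩
    obtain ⟨x, hx, rfl⟩ := List.mem_map.1 hy
    exact ⟨n, x, hu x hx, rfl⟩
  fn_mem := by
    intro k as hk has
    obtain ⟨N, hN⟩ := c.exists_lift_of_forall has
    obtain ⟨u, hu⟩ := hN N le_rfl
    have h : L.funArity k = some as.length ∧ ∃ p, c.IsLift as p := ⟨hk, (N, u), hu⟩
    rw [dif_pos h]
    have hp := h.2.choose_spec
    refine ⟨_, _, (c.A h.2.choose.1).fn_mem k _ ?_ hp.1, rfl⟩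
    exact hk.trans (congrArg some hp.length_eq.symm)

theorem exists_lift {as : List ℕ} (h : TupleIn c.limit as) :
    ∃ N, ∀ n, N ≤ n → ∃ u, c.IsLift as (n, u) :=
  c.exists_lift_of_forall h

variable {c} in
theorem IsLift.tupleIn {as : List ℕ} {p : ℕ × List ℕ} (h : c.IsLift as p) : TupleIn c.limit as := by
  obtain ⟨h1, rfl⟩ := h
  intro y hy
  obtain ⟨x, hx, rfl⟩ := List.mem_map.1 hy
  exact ⟨p.1, x, h1 x hx, rfl⟩

variable {c} in
theorem IsLift.fn_eq {as : List ℕ} {p : ℕ × List ℕ} (h : c.IsLift as p) {k : ℕ}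
    (hk : L.funArity k = some as.length) :
    c.limit.fn k as = c.e p.1 ((c.A p.1).fn k p.2) := by
  have h' : L.funArity k = some as.length ∧ ∃ p, c.IsLift as p := ⟨hk, p, h⟩
  simp only [limit]
  rw [dif_pos h']
  have hp := h'.2.choose_spec
  refine c.lift_fn hp.1 h.1 (by rw [hp.2, h.2]) ?_
  exact hk.trans (congrArg some hp.length_eq.symm)

theorem rel_of_sim {A B : Str L} {u v : List ℕ} (h : Sim A u B v) (r : ℕ) :
    A.rel r u ↔ B.rel r v := by
  obtain ⟨f, rfl, hf⟩ := h.exists_emb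
  have := hf.2.2.1 r u (tupleIn_sub h.1)
  rw [← this]
  exact (and_iff_left (tupleIn_sub h.1)).symm

variable {c} in
theorem IsLift.rel_iff {as : List ℕ} {p : ℕ × List ℕ} (h : c.IsLift as p) {r : ℕ} :
    c.limit.rel r as ↔ (c.A p.1).rel r p.2 := by
  constructor
  · rintro ⟨q, hq, hr⟩
    exact (rel_of_sim (c.lift_sim hq.1 h.1 (hq.2.trans h.2.symm)) r).1 hr
  · exact fun hr => ⟨p, h, hr⟩

theorem isEmbMap_e (n : ℕ) : IsEmbMap (c.A n) c.limit (c.e n) := by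
  refine ⟨fun x hx => ⟨n, x, hx, rfl⟩, c.inj n, fun r u hu => ?_, fun k u hk hu => ?_⟩
  · exact (IsLift.rel_iff (p := (n, u)) ⟨hu, rfl⟩).symm
  · exact (IsLift.fn_eq (p := (n, u)) ⟨hu, rfl⟩ (by simpa using hk)).symm

variable {c} in
theorem IsLift.sim {as : List ℕ} {p : ℕ × List ℕ} (h : c.IsLift as p) :
    Sim (c.A p.1) p.2 c.limit as := by
  have := (c.isEmbMap_e p.1).sim h.1
  rwa [h.2] at this

end DirectedChain

/-! ### The limit of the chain of amalgamation bases -/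

namespace Chain

variable {K : CompAge L} (C : Chain K)

theorem exists_f (n : ℕ) : ∃ f, (C.s n).map f = (C.s (n + 1)).take (C.s n).length ∧
    IsEmbMap (K.str (C.k n)) (K.str (C.k (n + 1))) f := by
  obtain ⟨f, hf, he⟩ := (C.emb n).exists_emb
  exact ⟨f, hf, he.of_sub fun x => (C.valid n).inClosure⟩

/-- The embedding of each stage into the next. -/
noncomputable def f (n : ℕ) : ℕ → ℕ := (C.exists_f n).choose

theorem f_spec (n : ℕ) : (C.s n).map (C.f n) = (C.s (n + 1)).take (C.s n).length ∧
    IsEmbMap (K.str (C.k n)) (K.str (C.k (n + 1))) (C.f n) := (C.exists_f n).choose_spec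

/-- The graph of the embedding of stage `n` into stage `n + 1`. -/
def Maps (n x y : ℕ) : Prop :=
  EI K (C.k n) (C.s n ++ [x]) (C.k (n + 1)) ((C.s (n + 1)).take (C.s n).length ++ [y])

theorem maps_iff {n x y : ℕ} : C.Maps n x y ↔ x ∈ (K.str (C.k n)).dom ∧ C.f n x = y := by
  obtain ⟨h1, h2⟩ := C.f_spec n
  constructor
  · intro h
    have hx : x ∈ (K.str (C.k n)).dom := h.1 x (by simp)
    refine ⟨hx, ?_⟩
    obtain ⟨g, hg, he⟩ := h.exists_emb
    rw [List.map_append] at hg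
    obtain ⟨hg1, hg2⟩ := List.append_inj' hg rfl
    have hgx : g x = y := by simpa using hg2
    rw [← hgx]
    have he' : IsEmbMap ((K.str (C.k n)).sub (C.s n)) (K.str (C.k (n + 1))) g :=
      he.comp (isEmbMap_sub.codRestrict fun z hz =>
        InClosure.mono (fun w hw => InClosure.of_mem h.1 w (by simp [hw])) hz)
    exact (h2.restrict _).eqOn he' (h1.trans hg1.symm) ((C.valid n).inClosure hx)
  · rintro ⟨hx, rfl⟩
    have := h2.sim ((C.valid n).1.append (t := [x]) (by simpa [TupleIn] using hx))
    rwa [List.map_append, h1] at this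

theorem compIn_maps : CompIn K.orc (fun p : ℕ × ℕ × ℕ => C.Maps p.1 p.2.1 p.2.2) := by
  have := C.compIn_k
  have := C.compIn_s
  unfold Maps
  fun_prop

theorem compIn_exists_maps : CompIn K.orc (fun p : ℕ × ℕ => ∃ x, C.Maps p.1 x p.2) := by
  have h : CompIn (jump (EmbedInfo K)) (fun p : (ℕ × List ℕ) × (ℕ × List ℕ) =>
      ∃ x : ℕ, EI K p.1.1 (p.1.2 ++ [x]) p.2.1 p.2.2) :=
    CompIn.exists_jump (R := fun (p : (ℕ × List ℕ) × (ℕ × List ℕ)) (x : ℕ) =>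
      EI K p.1.1 (p.1.2 ++ [x]) p.2.1 p.2.2) (by fun_prop)
  have := C.compIn_k
  have := C.compIn_s
  exact CompIn.comp (g := fun p : ℕ × ℕ => ((C.k p.1, C.s p.1),
    (C.k (p.1 + 1), (C.s (p.1 + 1)).take (C.s p.1).length ++ [p.2]))) h.of_jump (by fun_prop)

theorem exists_pre : ∃ g : ℕ × ℕ → ℕ, CompIn K.orc g ∧
    ∀ p : ℕ × ℕ, (∃ x, C.Maps p.1 x p.2) → C.Maps p.1 (g p) p.2 := by
  refine CompIn.find (R := fun (p : ℕ × ℕ) (x : ℕ) => (∃ x, C.Maps p.1 x p.2) → C.Maps p.1 x p.2)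
    (CompIn.imp (C.compIn_exists_maps.comp (by fun_prop)) ?_) fun p => ?_
  · exact CompIn.comp (g := fun p : (ℕ × ℕ) × ℕ => (p.1.1, p.2, p.1.2)) C.compIn_maps (by fun_prop)
  · by_cases h : ∃ x, C.Maps p.1 x p.2
    · obtain ⟨x, hx⟩ := h
      exact ⟨x, fun _ => hx⟩
    · exact ⟨0, fun hn => absurd hn h⟩

/-- A computable partial inverse of the embeddings. -/
noncomputable def pre : ℕ × ℕ → ℕ := C.exists_pre.choose

/-- Pull an element of some stage back to the preceding stage, if possible. -/
noncomputable def back (p : ℕ × ℕ) : ℕ × ℕ :=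
  if p.1 ≠ 0 ∧ ∃ x, C.Maps (p.1 - 1) x p.2 then (p.1 - 1, C.pre (p.1 - 1, p.2)) else p

theorem compIn_back : CompIn K.orc C.back := by
  have h1 := C.exists_pre.choose_spec.1
  have h2 := C.compIn_exists_maps
  change CompIn K.orc (fun p : ℕ × ℕ =>
    if p.1 ≠ 0 ∧ ∃ x, C.Maps (p.1 - 1) x p.2 then (p.1 - 1, C.pre (p.1 - 1, p.2)) else p)
  have a1 : CompIn K.orc (fun p : ℕ × ℕ => p.1 ≠ 0 ∧ ∃ x, C.Maps (p.1 - 1) x p.2) := by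
    have a3 : CompIn K.orc (fun p : ℕ × ℕ => p.1 ≠ 0) := by
      apply CompIn.not
      fun_prop
    exact a3.and (CompIn.comp (g := fun p : ℕ × ℕ => (p.1 - 1, p.2)) h2 (by fun_prop))
  have a2 : CompIn K.orc (fun p : ℕ × ℕ => (p.1 - 1, C.pre (p.1 - 1, p.2))) := by
    have a4 : CompIn K.orc (fun p : ℕ × ℕ => C.pre (p.1 - 1, p.2)) :=
      CompIn.comp (g := fun p : ℕ × ℕ => (p.1 - 1, p.2)) h1 (by fun_prop)
    exact CompIn.prodMk (by fun_prop) a4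
  convert CompIn.ite a1 a2 CompIn.id

theorem back_f {n x : ℕ} (hx : x ∈ (K.str (C.k n)).dom) : C.back (n + 1, C.f n x) = (n, x) := by
  have h : ∃ x', C.Maps n x' (C.f n x) := ⟨x, C.maps_iff.2 ⟨hx, rfl⟩⟩
  have h' := C.exists_pre.choose_spec.2 (n, C.f n x) h
  have : C.pre (n, C.f n x) = x := by
    obtain ⟨h1, h2⟩ := C.maps_iff.1 h'
    exact (C.f_spec n).2.2.1 _ h1 _ hx h2
  simp only [back, Nat.add_sub_cancel]
  rw [if_pos ⟨by simp, h⟩, this]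

theorem back_of_not {n y : ℕ} (h : ¬ ∃ x ∈ (K.str (C.k n)).dom, C.f n x = y) :
    C.back (n + 1, y) = (n + 1, y) := by
  refine if_neg fun h' => h ?_
  obtain ⟨-, x, hx⟩ := h'
  exact ⟨x, C.maps_iff.1 hx⟩

/-- The code in the limit of an element of stage `n`. -/
noncomputable def e (n x : ℕ) : ℕ := Nat.pair (C.back^[n] (n, x)).1 (C.back^[n] (n, x)).2

theorem e_zero (x : ℕ) : C.e 0 x = Nat.pair 0 x := rfl

theorem e_f {n x : ℕ} (hx : x ∈ (K.str (C.k n)).dom) : C.e (n + 1) (C.f n x) = C.e n x := by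
  rw [e, Function.iterate_succ_apply, C.back_f hx, e]

theorem e_of_not {n y : ℕ} (h : ¬ ∃ x ∈ (K.str (C.k n)).dom, C.f n x = y) :
    C.e (n + 1) y = Nat.pair (n + 1) y := by
  rw [e, Function.iterate_fixed (C.back_of_not h)]

theorem compIn_e {α : Type*} [Primcodable α] {f g : α → ℕ} (hf : CompIn K.orc f)
    (hg : CompIn K.orc g) : CompIn K.orc (fun a => C.e (f a) (g a)) := by
  have := CompIn.iterate C.compIn_back hf (hf.prodMk hg)
  unfold e
  fun_prop

/-- Every code of an element is the code of the pair it encodes, and this pair has minimal first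
component. -/
theorem unpair_e (n : ℕ) : ∀ x ∈ (K.str (C.k n)).dom, (C.e n x).unpair.1 ≤ n ∧
    (C.e n x).unpair.2 ∈ (K.str (C.k (C.e n x).unpair.1)).dom ∧
    C.e (C.e n x).unpair.1 (C.e n x).unpair.2 = C.e n x := by
  induction n with
  | zero => intro x hx; simp [e_zero, hx]
  | succ n ih =>
    intro y hy
    by_cases h : ∃ x ∈ (K.str (C.k n)).dom, C.f n x = y
    · obtain ⟨x, hx, rfl⟩ := h
      rw [C.e_f hx]
      obtain ⟨h1, h2⟩ := ih x hx
      exact ⟨by omega, h2⟩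
    · simp [C.e_of_not h, hy]

theorem e_inj (n : ℕ) : ∀ x ∈ (K.str (C.k n)).dom, ∀ y ∈ (K.str (C.k n)).dom,
    C.e n x = C.e n y → x = y := by
  induction n with
  | zero => intro x _ y _ h; simpa [e_zero] using h
  | succ n ih =>
    have key : ∀ x ∈ (K.str (C.k n)).dom, ∀ y,
        (¬ ∃ x ∈ (K.str (C.k n)).dom, C.f n x = y) → C.e n x ≠ C.e (n + 1) y := by
      intro x hx y hy h
      have := (C.unpair_e n x hx).1
      rw [h, C.e_of_not hy] at this
      simp at this
    intro x hx y hy h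
    by_cases h1 : ∃ x' ∈ (K.str (C.k n)).dom, C.f n x' = x <;>
      by_cases h2 : ∃ y' ∈ (K.str (C.k n)).dom, C.f n y' = y
    · obtain ⟨x', hx', rfl⟩ := h1
      obtain ⟨y', hy', rfl⟩ := h2
      rw [C.e_f hx', C.e_f hy'] at h
      rw [ih x' hx' y' hy' h]
    · obtain ⟨x', hx', rfl⟩ := h1
      rw [C.e_f hx'] at h
      exact absurd h (key x' hx' y h2)
    · obtain ⟨y', hy', rfl⟩ := h2
      rw [C.e_f hy'] at h
      exact absurd h.symm (key y' hy' x h1)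
    · rw [C.e_of_not h1, C.e_of_not h2] at h
      simpa using h

/-- The chain of amalgamation bases as a directed chain of embeddings. -/
noncomputable def directed : DirectedChain L where
  A n := K.str (C.k n)
  f := C.f
  emb n := (C.f_spec n).2
  e := C.e
  inj := C.e_inj
  compat _ _ hx := C.e_f hx

/-- The limit structure. -/
noncomputable abbrev lim : Str L := C.directed.limit

theorem mem_lim_dom {y : ℕ} : y ∈ C.lim.dom ↔ EI K (C.k y.unpair.1) [y.unpair.2]
    (C.k y.unpair.1) [y.unpair.2] ∧ C.e y.unpair.1 y.unpair.2 = y := by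
  rw [EI_self_singleton]
  constructor
  · rintro ⟨n, x, hx, rfl⟩
    exact (C.unpair_e n x hx).2
  · rintro ⟨h1, h2⟩
    exact ⟨_, _, h1, h2⟩

theorem compIn_mem_dom {α : Type*} [Primcodable α] {f : α → ℕ} (hf : CompIn K.orc f) :
    CompIn K.orc (fun a => f a ∈ C.lim.dom) := by
  have h1 := C.compIn_k
  have h2 : CompIn K.orc (fun a => C.e (f a).unpair.1 (f a).unpair.2) :=
    C.compIn_e (by fun_prop) (by fun_prop)
  simp only [mem_lim_dom]
  fun_prop

theorem compIn_tupleIn {α : Type*} [Primcodable α] {f : α → List ℕ} (hf : CompIn K.orc f) :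
    CompIn K.orc (fun a => TupleIn C.lim (f a)) :=
  CompIn.ball_mem (R := fun _ x => x ∈ C.lim.dom) (C.compIn_mem_dom (by fun_prop)) hf

theorem compIn_isLift :
    CompIn K.orc (fun q : List ℕ × (ℕ × List ℕ) => C.directed.IsLift q.1 q.2) := by
  have h1 := C.compIn_k
  have h2 : CompIn K.orc (fun q : List ℕ × (ℕ × List ℕ) => ∀ i < q.1.length,
      C.e q.2.1 (q.2.2.getD i 0) = q.1.getD i 0) :=
    CompIn.ball_lt
      (R := fun (q : List ℕ × (ℕ × List ℕ)) i => C.e q.2.1 (q.2.2.getD i 0) = q.1.getD i 0)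
      (CompIn.eq (C.compIn_e (by fun_prop) (by fun_prop)) (by fun_prop)) (by fun_prop)
  have h3 : CompIn K.orc (fun q : List ℕ × (ℕ × List ℕ) =>
      EI K (C.k q.2.1) q.2.2 (C.k q.2.1) q.2.2 ∧ q.2.2.length = q.1.length) := by fun_prop
  refine (h3.and h2).congr_iff fun ⟨as, n, u⟩ => ?_
  rw [EI_self]
  dsimp only
  constructor
  · rintro ⟨h1, rfl⟩
    refine ⟨⟨h1, by simp⟩, fun i hi => ?_⟩
    have hi' : i < u.length := by simpa using hi
    rw [List.getD_eq_getElem _ _ hi, List.getD_eq_getElem _ _ hi', List.getElem_map]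
    rfl
  · rintro ⟨⟨h1, h2⟩, h3⟩
    refine ⟨h1, List.ext_getElem (by simpa using h2) fun i hi hi' => ?_⟩
    have hi'' : i < u.length := by simpa using hi
    have := h3 i hi'
    rw [List.getD_eq_getElem _ _ hi', List.getD_eq_getElem _ _ hi''] at this
    rw [List.getElem_map]
    exact this

theorem exists_rep : ∃ g : List ℕ → ℕ × List ℕ, CompIn K.orc g ∧
    ∀ as, TupleIn C.lim as → C.directed.IsLift as (g as) := by
  refine CompIn.find (R := fun as p => TupleIn C.lim as → C.directed.IsLift as p)
    (CompIn.imp (C.compIn_tupleIn (by fun_prop)) C.compIn_isLift) fun as => ?_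
  by_cases h : TupleIn C.lim as
  · obtain ⟨N, hN⟩ := C.directed.exists_lift h
    obtain ⟨u, hu⟩ := hN N le_rfl
    exact ⟨(N, u), fun _ => hu⟩
  · exact ⟨default, fun hn => absurd hn h⟩

/-- A computable lift of tuples of the limit to the stages of the chain. -/
noncomputable def rep : List ℕ → ℕ × List ℕ := C.exists_rep.choose

theorem isLift_rep {as : List ℕ} (h : TupleIn C.lim as) : C.directed.IsLift as (C.rep as) :=
  C.exists_rep.choose_spec.2 as h

theorem compIn_rep {α : Type*} [Primcodable α] {f : α → List ℕ} (hf : CompIn K.orc f) :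
    CompIn K.orc (fun a => C.rep (f a)) :=
  CompIn.comp C.exists_rep.choose_spec.1 hf

theorem compIn_sim {α : Type*} [Primcodable α] {f g : α → List ℕ} (hf : CompIn K.orc f)
    (hg : CompIn K.orc g) : CompIn K.orc (fun a => Sim C.lim (f a) C.lim (g a)) := by
  have h1 := C.compIn_k
  have h2 := C.compIn_rep hf
  have h3 := C.compIn_rep hg
  have h4 : CompIn K.orc (fun a => EI K (C.k (C.rep (f a)).1) (C.rep (f a)).2
    (C.k (C.rep (g a)).1) (C.rep (g a)).2) := by fun_prop
  refine (((C.compIn_tupleIn hf).and (C.compIn_tupleIn hg)).and h4).congr_iff fun a => ?_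
  constructor
  · intro h
    refine ⟨⟨h.1, h.2.1⟩, ?_⟩
    exact ((C.isLift_rep h.1).sim.trans h).trans (C.isLift_rep h.2.1).sim.symm
  · rintro ⟨⟨h1, h2⟩, h⟩
    exact ((C.isLift_rep h1).sim.symm.trans h).trans (C.isLift_rep h2).sim

variable [hK : FraisseAge K]

theorem compIn_base {α : Type*} [Primcodable α] {f : α → List ℕ} (hf : CompIn K.orc f) :
    CompIn K.orc (fun a => TupleIn C.lim (f a) ∧ AmalgBase K.cls (C.lim.sub (f a))) := by
  have h1 := C.compIn_k
  have h2 := C.compIn_rep hf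
  have h3 : CompIn K.orc (fun a => Base K (C.k (C.rep (f a)).1) (C.rep (f a)).2) := by fun_prop
  refine ((C.compIn_tupleIn hf).and h3).congr_iff fun a => and_congr_right fun h => ?_
  have hs := (C.isLift_rep h).sim
  rw [← hs.amalgBase_iff cls_isom]
  exact (and_iff_right hs.1).symm

theorem strComputableIn : StrComputableIn K.orc C.lim := by
  have hk := C.compIn_k
  refine ⟨CompIn.setRecIn_iff.2 (C.compIn_mem_dom (by fun_prop)), CompIn.setRecIn_iff.2 ?_,
    CompIn.setRecIn_iff.2 ?_⟩
  · have h1 : CompIn K.orc (fun p : ℕ => C.rep (CompIn.decodeD (List ℕ) p.unpair.2)) :=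
      C.compIn_rep (by fun_prop)
    have h2 : CompIn K.orc (fun p : ℕ => TupleIn C.lim (CompIn.decodeD (List ℕ) p.unpair.2)) :=
      C.compIn_tupleIn (by fun_prop)
    have h3 : CompIn K.orc (fun p : ℕ => Encodable.encode (CompIn.decodeD (List ℕ) p.unpair.2) =
        p.unpair.2 ∧ Nat.pair 2 (Nat.pair (C.k (C.rep (CompIn.decodeD (List ℕ) p.unpair.2)).1)
          (Nat.pair p.unpair.1 (Encodable.encode (C.rep (CompIn.decodeD (List ℕ) p.unpair.2)).2))) ∈
          K.diag) := by fun_prop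
    refine (h2.and h3).congr_iff fun p => ?_
    rw [mem_diag_two]
    constructor
    · rintro ⟨r, as, h, hr, rfl⟩
      simp only [Nat.unpair_pair, CompIn.decodeD_encode, true_and]
      have hl := C.isLift_rep h
      exact ⟨h, hl.1, hl.rel_iff.1 hr⟩
    · rintro ⟨h, h', -, hr⟩
      have hl := C.isLift_rep h
      refine ⟨_, _, h, hl.rel_iff.2 hr, ?_⟩
      rw [h', Nat.pair_unpair]
  · have h1 : CompIn K.orc (fun p : ℕ => C.rep (p.unpair.2.unpair.2 ::
        CompIn.decodeD (List ℕ) p.unpair.2.unpair.1)) := C.compIn_rep (by fun_prop)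
    have h2 : CompIn K.orc (fun p : ℕ => TupleIn C.lim (p.unpair.2.unpair.2 ::
        CompIn.decodeD (List ℕ) p.unpair.2.unpair.1)) := C.compIn_tupleIn (by fun_prop)
    have h3 : CompIn K.orc (fun p : ℕ =>
        Encodable.encode (CompIn.decodeD (List ℕ) p.unpair.2.unpair.1) = p.unpair.2.unpair.1 ∧
        Nat.pair 4 (Nat.pair (C.k (C.rep (p.unpair.2.unpair.2 ::
            CompIn.decodeD (List ℕ) p.unpair.2.unpair.1)).1)
          (Nat.pair p.unpair.1 (Nat.pair (Encodable.encode (C.rep (p.unpair.2.unpair.2 ::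
            CompIn.decodeD (List ℕ) p.unpair.2.unpair.1)).2.tail)
            ((C.rep (p.unpair.2.unpair.2 ::
              CompIn.decodeD (List ℕ) p.unpair.2.unpair.1)).2.getD 0 0)))) ∈ K.diag) := by
      fun_prop
    have key : ∀ f as b, TupleIn C.lim (b :: as) →
        (TupleIn (K.str (C.k (C.rep (b :: as)).1)) (C.rep (b :: as)).2.tail ∧
          L.funArity f = some (C.rep (b :: as)).2.tail.length ∧
          (K.str (C.k (C.rep (b :: as)).1)).fn f (C.rep (b :: as)).2.tail =
            (C.rep (b :: as)).2.getD 0 0 ↔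
          L.funArity f = some as.length ∧ C.lim.fn f as = b) := by
      intro f as b h
      have hl := C.isLift_rep h
      generalize C.rep (b :: as) = q at hl
      obtain ⟨n, v⟩ := q
      obtain ⟨hv, hm⟩ := hl
      cases v with
      | nil => simp at hm
      | cons x u =>
        simp only [List.map_cons, List.cons.injEq] at hm
        obtain ⟨rfl, rfl⟩ := hm
        have hu : TupleIn (K.str (C.k n)) u := fun y hy => hv y (by simp [hy])
        simp only [List.tail_cons, List.length_map, List.getD_cons_zero, hu, true_and]
        refine and_congr_right fun hf => ?_
        rw [DirectedChain.IsLift.fn_eq (c := C.directed) (p := (n, u)) ⟨hu, rfl⟩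
          (by simpa using hf)]
        exact ⟨fun h => congrArg _ h, fun h => C.e_inj n _ ((K.str (C.k n)).fn_mem f u hf hu) _
          (hv x (by simp)) h⟩
    refine (h2.and h3).congr_iff fun p => ?_
    rw [mem_diag_four]
    constructor
    · rintro ⟨f, as, b, hf, h, rfl, rfl⟩
      simp only [Nat.unpair_pair, CompIn.decodeD_encode, true_and]
      have h' : TupleIn C.lim (C.lim.fn f as :: as) := by
        intro x hx
        rcases List.mem_cons.1 hx with rfl | hx
        exacts [C.lim.fn_mem f as hf h, h x hx]
      exact ⟨h', (key _ _ _ h').2 ⟨hf, rfl⟩⟩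
    · rintro ⟨h, h', hr⟩
      obtain ⟨h1, h2⟩ := (key _ _ _ h).1 hr
      refine ⟨_, _, _, h1, fun x hx => h x (by simp [hx]), h2, ?_⟩
      rw [h', Nat.pair_unpair, Nat.pair_unpair]

end Chain

theorem Sim.append_unique {A B : Str L} {s t u v v' : List ℕ} (h : Sim A (s ++ u) B (t ++ v))
    (h' : Sim A (s ++ u) B (t ++ v')) (hl : s.length = t.length)
    (hu : ∀ x ∈ u, InClosure A s x) : v = v' := by
  obtain ⟨f, hf, hf'⟩ := h.exists_emb
  obtain ⟨g, hg, hg'⟩ := h'.exists_emb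
  rw [List.map_append] at hf hg
  obtain ⟨h1, rfl⟩ := List.append_inj hf (by simpa using hl)
  obtain ⟨h2, rfl⟩ := List.append_inj hg (by simpa using hl)
  refine List.map_congr_left fun x hx => ?_
  refine (hf'.restrict s).eqOn (hg'.restrict s) (h1.trans h2.symm) ?_
  exact (inClosure_sub fun y hy => InClosure.base (by simp [hy]) (h.1 y (by simp [hy]))).2 (hu x hx)

namespace Chain

variable {K : CompAge L} (C : Chain K)

/-- The tuple chosen at stage `n`, as a tuple of the limit. -/
noncomputable def st (n : ℕ) : List ℕ := (C.s n).map (C.e n)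

theorem st_prefix {n m : ℕ} (h : n ≤ m) : C.st n <+: C.st m := by
  induction m, h using Nat.le_induction with
  | base => exact List.prefix_rfl
  | succ m _ ih =>
    refine ih.trans ?_
    have h1 : C.st m = ((C.s (m + 1)).take (C.s m).length).map (C.e (m + 1)) := by
      rw [← (C.f_spec m).1, List.map_map]
      exact List.map_congr_left fun x hx => (C.e_f ((C.valid m).1 x hx)).symm
    rw [h1, List.map_take]
    exact List.take_prefix _ _

theorem isLift_st (n : ℕ) : C.directed.IsLift (C.st n) (n, C.s n) := ⟨(C.valid n).1, rfl⟩

theorem exists_ext_of_mem_st {n l : ℕ} {b c t : List ℕ} (hbn : ∀ x ∈ b, x ∈ C.st n)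
    (hb : AmalgBase K.cls (C.lim.sub b)) (hc : Sim C.lim b (K.str l) c)
    (ht : TupleIn (K.str l) t) :
    ∃ m d, (∀ x ∈ d, x ∈ C.st m) ∧ Sim (K.str l) (c ++ t) C.lim (b ++ d) := by
  obtain ⟨I, hI, rfl⟩ := exists_sel hbn
  have key : ∀ m, n ≤ m → (∀ i ∈ I, i < (C.s m).length) ∧
      C.directed.IsLift (sel (C.st n) I) (m, sel (C.s m) I) := by
    intro m hm
    obtain ⟨r, hr⟩ := C.st_prefix hm
    have h1 : ∀ i ∈ I, i < (C.s m).length := by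
      intro i hi
      have : (C.st n ++ r).length = (C.s m).length := by rw [hr, st, List.length_map]
      rw [← this, List.length_append]
      exact (hI i hi).trans_le (Nat.le_add_right _ _)
    refine ⟨h1, fun x hx => (C.valid m).1 x (mem_of_mem_sel h1 hx), ?_⟩
    rw [← sel_append hI (u := r), hr, st, sel_map h1]
    rfl
  let q : Task := (I, l, c, t)
  have hm : n ≤ Nat.pair (Encodable.encode q) n := Nat.right_le_pair _ _
  obtain ⟨h1, h2⟩ := key _ hm
  have hq : CompIn.decodeD Task (Nat.pair (Encodable.encode q) n).unpair.1 = q := by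
    rw [Nat.unpair_pair, CompIn.decodeD_encode]
  have ha := C.task (Nat.pair (Encodable.encode q) n)
  rw [hq] at ha
  obtain ⟨d, hd, hd'⟩ := ha ⟨h1, ⟨h2.1, (h2.sim.amalgBase_iff cls_isom).2 hb⟩,
    h2.sim.trans hc, ht⟩
  obtain ⟨h3, h4⟩ := key (Nat.pair (Encodable.encode q) n + 1) (hm.trans (Nat.le_succ _))
  refine ⟨Nat.pair (Encodable.encode q) n + 1,
    d.map (C.e (Nat.pair (Encodable.encode q) n + 1)), fun x hx => ?_, ?_⟩
  · obtain ⟨y, hy, rfl⟩ := List.mem_map.1 hx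
    exact List.mem_map_of_mem (hd y hy)
  · have := hd'.trans ((C.directed.isEmbMap_e _).sim hd'.2.1)
    rw [List.map_append] at this
    have h5 := h4.2
    dsimp only at h5
    rwa [h5] at this

theorem base_st {n : ℕ} (hn : 0 < n) : AmalgBase K.cls (C.lim.sub (C.st n)) :=
  ((C.isLift_st n).sim.amalgBase_iff cls_isom).1 (C.base n hn).2

theorem exists_mem_st {y : ℕ} (hy : y ∈ C.lim.dom) : ∃ n, y ∈ C.st n := by
  obtain ⟨N, hN⟩ := C.directed.exists_lift (as := [y]) (by simpa [TupleIn] using hy)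
  obtain ⟨u, hu⟩ := hN (N + 1) (Nat.le_succ _)
  obtain ⟨m, d, h1, h2⟩ := C.exists_ext_of_mem_st (n := N + 1) (fun x hx => hx)
    (C.base_st (Nat.succ_pos _)) (C.isLift_st (N + 1)).sim.symm hu.1
  have h3 : Sim (K.str (C.k (N + 1))) (C.s (N + 1) ++ u) C.lim (C.st (N + 1) ++ [y]) := by
    have := (C.directed.isEmbMap_e (N + 1)).sim ((C.valid (N + 1)).1.append hu.1)
    rw [List.map_append, hu.2] at this
    exact this
  have := h3.append_unique h2 (by rw [st, List.length_map])
    fun x hx => (C.valid (N + 1)).inClosure (hu.1 x hx)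
  exact ⟨m, h1 y (by simp [← this])⟩

theorem exists_forall_mem_st {as : List ℕ} (h : TupleIn C.lim as) :
    ∃ n, 0 < n ∧ ∀ x ∈ as, x ∈ C.st n := by
  induction as with
  | nil => exact ⟨1, one_pos, by simp⟩
  | cons a as ih =>
    obtain ⟨n, hn, h1⟩ := ih fun x hx => h x (List.mem_cons_of_mem _ hx)
    obtain ⟨m, h2⟩ := C.exists_mem_st (h a List.mem_cons_self)
    refine ⟨max n m, by omega, fun x hx => ?_⟩
    rcases List.mem_cons.1 hx with rfl | hx
    · exact (C.st_prefix (le_max_right n m)).subset h2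
    · exact (C.st_prefix (le_max_left n m)).subset (h1 x hx)

/-- The extension property of the limit over amalgamation bases. -/
theorem exists_ext {l : ℕ} {b c t : List ℕ} (hb : AmalgBase K.cls (C.lim.sub b))
    (hc : Sim C.lim b (K.str l) c) (ht : TupleIn (K.str l) t) :
    ∃ d, Sim (K.str l) (c ++ t) C.lim (b ++ d) := by
  obtain ⟨n, -, hn⟩ := C.exists_forall_mem_st hc.1
  obtain ⟨-, d, -, h⟩ := C.exists_ext_of_mem_st hn hb hc ht
  exact ⟨d, h⟩

/-- One half of a back-and-forth step. -/
theorem exists_forth {as bs : List ℕ} (hb : AmalgBase K.cls (C.lim.sub as))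
    (h : Sim C.lim as C.lim bs) {y : ℕ} (hy : y ∈ C.lim.dom) :
    ∃ u v, y ∈ u ∧ AmalgBase K.cls (C.lim.sub (as ++ u)) ∧
      Sim C.lim (as ++ u) C.lim (bs ++ v) := by
  obtain ⟨n, hn, hmem⟩ := C.exists_forall_mem_st (as := y :: as) (by
    intro x hx
    rcases List.mem_cons.1 hx with rfl | hx
    exacts [hy, h.1 x hx])
  obtain ⟨I, hI, has⟩ := exists_sel fun x hx => hmem x (List.mem_cons_of_mem _ hx)
  have hI' : ∀ i ∈ I, i < (C.s n).length := fun i hi => by simpa [st] using hI i hi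
  have hl : C.directed.IsLift as (n, sel (C.s n) I) :=
    ⟨fun x hx => (C.valid n).1 x (mem_of_mem_sel hI' hx), by
      rw [← has, st, sel_map hI']; rfl⟩
  obtain ⟨v, hv⟩ := C.exists_ext ((h.amalgBase_iff cls_isom).1 hb)
    (h.symm.trans hl.sim.symm) (C.valid n).1
  have hs : Sim (K.str (C.k n)) (sel (C.s n) I ++ C.s n) C.lim (as ++ C.st n) := by
    have := (C.directed.isEmbMap_e n).sim (hl.1.append (C.valid n).1)
    rw [List.map_append, hl.2] at this
    exact this
  refine ⟨C.st n, v, hmem y List.mem_cons_self, ?_, hs.symm.trans hv⟩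
  refine (hs.amalgBase_iff cls_isom).1 ?_
  exact ((Base.amalgBase (σ := (C.k n, C.s n)) (C.base n hn) (C.valid n)).base
    (hl.1.append (C.valid n).1) fun x hx =>
      InClosure.mono (fun y hy => InClosure.base (by simp [hy]) ((C.valid n).1 y hy))
        ((C.valid n).inClosure hx)).2

end Chain

/-! ### Back-and-forth -/

section BackAndForth

variable {M : Str L}

theorem eq_of_map_map_eq {f g : ℕ → ℕ} {l : List ℕ} (h : (l.map f).map g = l) :
    ∀ x ∈ l, g (f x) = x := by
  rw [List.map_map] at h
  exact List.map_inj_left.1 (h.trans (List.map_id l).symm)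

theorem tupleSim_iff {as bs : List ℕ} : TupleSim as bs ↔ as.length = bs.length ∧
    ∀ i < as.length, ∀ j < as.length,
      (as.getD i 0 = as.getD j 0 ↔ bs.getD i 0 = bs.getD j 0) := by
  have key : ∀ {s t : List ℕ}, s.length = t.length → (∀ i < s.length, ∀ j < s.length,
      s.getD i 0 = s.getD j 0 → t.getD i 0 = t.getD j 0) → ∃ h : ℕ → ℕ, s.map h = t := by
    intro s t hl h
    refine ⟨fun x => t.getD (s.idxOf x) 0, List.ext_getElem (by simpa using hl) fun i h1 h2 => ?_⟩
    have hi : i < s.length := by simpa using h1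
    have hj : s.idxOf s[i] < s.length := List.idxOf_lt_length_of_mem (List.getElem_mem hi)
    rw [List.getElem_map, h _ hj i hi, List.getD_eq_getElem]
    rw [List.getD_eq_getElem _ _ hj, List.getD_eq_getElem _ _ hi, List.getElem_idxOf]
  constructor
  · rintro ⟨h, h', rfl, h2⟩
    refine ⟨by simp, fun i hi j hj => ?_⟩
    replace h2 := eq_of_map_map_eq h2
    have hi' : i < (as.map h).length := by simpa using hi
    have hj' : j < (as.map h).length := by simpa using hj
    rw [List.getD_eq_getElem _ _ hj, List.getD_eq_getElem _ _ hi, List.getD_eq_getElem _ _ hi',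
      List.getD_eq_getElem _ _ hj', List.getElem_map, List.getElem_map]
    refine ⟨fun e => by rw [e], fun e => ?_⟩
    rw [← h2 _ (List.getElem_mem hi), ← h2 _ (List.getElem_mem hj)]
    exact congrArg h' e
  · rintro ⟨hl, h⟩
    obtain ⟨f, hf⟩ := key hl fun i hi j hj => (h i hi j hj).1
    obtain ⟨g, hg⟩ := key hl.symm fun i hi j hj =>
      (h i (hl.symm ▸ hi) j (hl.symm ▸ hj)).2
    exact ⟨f, g, hf, hg⟩

theorem TupleSim.symm {as bs : List ℕ} (h : TupleSim as bs) : TupleSim bs as := by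
  obtain ⟨f, g, hf, hg⟩ := h
  exact ⟨g, f, hg, hf⟩

/-- The tuples of `σ` lie in `M` and have the same equality pattern. -/
def PartialInj (M : Str L) (σ : List ℕ × List ℕ) : Prop :=
  TupleIn M σ.1 ∧ TupleIn M σ.2 ∧ TupleSim σ.1 σ.2

theorem TupleSim.card_eq {as bs : List ℕ} (h : TupleSim as bs) :
    as.toFinset.card = bs.toFinset.card := by
  have key : ∀ {s t : List ℕ}, TupleSim s t → s.toFinset.card ≤ t.toFinset.card := by
    rintro s t ⟨f, g, -, rfl⟩
    refine Finset.card_le_card_of_surjOn g fun x hx => ?_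
    simpa using hx
  exact le_antisymm (key h) (key h.symm)

theorem PartialInj.exists_forth {as bs : List ℕ} (h : PartialInj M (as, bs)) {x : ℕ}
    (hx : x ∈ M.dom) : ∃ u v, x ∈ as ++ u ∧ PartialInj M (as ++ u, bs ++ v) := by
  obtain ⟨h1, h2, h3⟩ := h
  dsimp only at h1 h2 h3
  by_cases hxa : x ∈ as
  · exact ⟨[], [], by simpa using hxa, by simpa using h1, by simpa using h2, by simpa using h3⟩
  have hy : ∃ y ∈ M.dom, y ∉ bs := by
    by_contra! hcon
    have h4 : insert x as.toFinset ⊆ bs.toFinset := by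
      intro z hz
      rcases Finset.mem_insert.1 hz with rfl | hz
      · exact List.mem_toFinset.2 (hcon _ hx)
      · exact List.mem_toFinset.2 (hcon _ (h1 _ (List.mem_toFinset.1 hz)))
    have h5 := Finset.card_le_card h4
    rw [Finset.card_insert_of_notMem (by simpa using hxa), h3.card_eq] at h5
    omega
  obtain ⟨y, hy, hyb⟩ := hy
  refine ⟨[x], [y], by simp, h1.append (by simpa [TupleIn] using hx),
    h2.append (by simpa [TupleIn] using hy), ?_⟩
  obtain ⟨f, g, hf, hg⟩ := h3
  refine ⟨Function.update f x y, Function.update g y x, ?_, ?_⟩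
  · rw [List.map_append, List.map_congr_left (g := f), hf]
    · simp
    · intro z hz
      exact Function.update_of_ne (ne_of_mem_of_not_mem hz hxa) _ _
  · rw [List.map_append, List.map_congr_left (g := g), hg]
    · simp
    · intro z hz
      exact Function.update_of_ne (ne_of_mem_of_not_mem hz hyb) _ _

/-- The union of a sequence of finite partial injections is a bijection. -/
theorem bijOnDom_of_approx {r : ℕ → List ℕ × List ℕ} {g : ℕ → ℕ}
    (hr : ∀ n, (r n).1 <+: (r (n + 1)).1 ∧ (r n).2 <+: (r (n + 1)).2)
    (hi : ∀ n, PartialInj M (r n))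
    (hm : ∀ n ∈ M.dom, n ∈ (r (n + 1)).1 ∧ n ∈ (r (n + 1)).2)
    (hg : ∀ x ∈ M.dom, ∃ h : ℕ → ℕ, (r (x + 1)).1.map h = (r (x + 1)).2 ∧ g x = h x) :
    BijOnDom M g ∧ ∀ n, (r n).1.map g = (r n).2 := by
  have hmono : ∀ {n m}, n ≤ m → (r n).1 <+: (r m).1 ∧ (r n).2 <+: (r m).2 := by
    intro n m h
    induction m, h using Nat.le_induction with
    | base => exact ⟨List.prefix_rfl, List.prefix_rfl⟩
    | succ m _ ih => exact ⟨ih.1.trans (hr m).1, ih.2.trans (hr m).2⟩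
  have hmap : ∀ {n m} {h : ℕ → ℕ}, n ≤ m → (r m).1.map h = (r m).2 → (r n).1.map h = (r n).2 := by
    intro n m h hnm hh
    obtain ⟨⟨u, hu⟩, v, hv⟩ := hmono hnm
    rw [← hu, ← hv, List.map_append] at hh
    refine (List.append_inj hh ?_).1
    rw [List.length_map]
    exact (tupleSim_iff.1 (hi n).2.2).1
  have hmg : ∀ n, (r n).1.map g = (r n).2 := by
    intro n
    obtain ⟨h, -, hh, -⟩ := (hi n).2.2
    rw [← hh]
    refine List.map_congr_left fun x hx => ?_
    have hxd := (hi n).1 x hx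
    obtain ⟨h', hh', hgx⟩ := hg x hxd
    obtain ⟨h'', -, hh'', -⟩ := (hi (max n (x + 1))).2.2
    have e1 := (hmap (le_max_left n (x + 1)) hh'').trans hh.symm
    have e2 := (hmap (le_max_right n (x + 1)) hh'').trans hh'.symm
    rw [hgx, ← List.map_inj_left.1 e1 x hx, List.map_inj_left.1 e2 x (hm x hxd).1]
  refine ⟨⟨fun x hx => ?_, fun x hx y hy h => ?_, fun y hy => ?_⟩, hmg⟩
  · refine (hi (x + 1)).2.1 _ ?_
    rw [← hmg]
    exact List.mem_map_of_mem (hm x hx).1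
  · obtain ⟨-, h', -, hh'⟩ := (hi (max x y + 1)).2.2
    rw [← hmg] at hh'
    replace hh' := eq_of_map_map_eq hh'
    have hx' := hh' x ((hmono (by omega)).1.subset (hm x hx).1)
    have hy' := hh' y ((hmono (by omega)).1.subset (hm y hy).1)
    rw [← hx', ← hy']
    exact congrArg h' h
  · have := (hm y hy).2
    rw [← hmg] at this
    obtain ⟨x, hx, rfl⟩ := List.mem_map.1 this
    exact ⟨x, (hi _).1 x hx, rfl⟩

theorem isAutoOf_of_sim {g : ℕ → ℕ} (hb : BijOnDom M g)
    (h : ∀ u, TupleIn M u → Sim M u M (u.map g)) : IsAutoOf M g := by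
  refine ⟨⟨hb.1, hb.2.1, fun r u hu => DirectedChain.rel_of_sim (h u hu) r, fun k u hk hu => ?_⟩,
    hb.2.2⟩
  have hu' : TupleIn M (u ++ [M.fn k u]) :=
    hu.append (by simpa [TupleIn] using M.fn_mem k u hk hu)
  obtain ⟨f, hf, hf'⟩ := (h _ hu').exists_emb
  rw [List.map_inj_left] at hf
  rw [← hf _ (by simp)]
  have := hf'.2.2.2 k u hk fun x hx => InClosure.of_mem hu' x (by simp [hx])
  refine Eq.trans this ?_
  rw [List.map_congr_left fun x hx => hf x (by simp [hx])]

theorem isAutoOf_of_approx {r : ℕ → List ℕ × List ℕ} {g : ℕ → ℕ} (hb : BijOnDom M g)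
    (hmono : ∀ u, TupleIn M u → ∃ n, ∀ x ∈ u, x ∈ (r n).1)
    (hg : ∀ n, (r n).1.map g = (r n).2) (hs : ∀ n, Sim M (r n).1 M (r n).2) : IsAutoOf M g := by
  refine isAutoOf_of_sim hb fun u hu => ?_
  obtain ⟨n, hn⟩ := hmono u hu
  obtain ⟨f, hf, hf'⟩ := (hs n).exists_emb
  have := hf'.sim_of_sub (u := u) fun x hx => InClosure.of_mem (hs n).1 x (hn x hx)
  rw [← hg n, List.map_inj_left] at hf
  rwa [List.map_congr_left fun x hx => hf x (hn x hx)] at this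

end BackAndForth

namespace Chain

variable {K : CompAge L} (C : Chain K)

/-- The tuples generating amalgamation bases. -/
def bases : Set (List ℕ) := {as | TupleIn C.lim as ∧ AmalgBase K.cls (C.lim.sub as)}

/-- The pair `σ` consists of isomorphic tuples generating amalgamation bases. -/
def PartialIso (σ : List ℕ × List ℕ) : Prop := σ.1 ∈ C.bases ∧ Sim C.lim σ.1 C.lim σ.2

/-- The pair `τ` is an extension of `σ` handling the element `x`. -/
def StepRel (σ : List ℕ × List ℕ) (x : ℕ) (τ : List ℕ × List ℕ) : Prop :=
  τ.1.take σ.1.length = σ.1 ∧ τ.2.take σ.2.length = σ.2 ∧ PartialInj C.lim τ ∧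
    (x ∈ C.lim.dom → x ∈ τ.1 ∧ x ∈ τ.2) ∧ (C.PartialIso σ → C.PartialIso τ)

theorem exists_stepRel {σ : List ℕ × List ℕ} (hσ : PartialInj C.lim σ) (x : ℕ) :
    ∃ τ, C.StepRel σ x τ := by
  obtain ⟨as, bs⟩ := σ
  by_cases hx : x ∈ C.lim.dom
  swap
  · exact ⟨(as, bs), by simp, by simp, hσ, fun h => absurd h hx, fun h => h⟩
  by_cases hp : C.PartialIso (as, bs)
  · obtain ⟨⟨-, h1⟩, h2⟩ := hp
    obtain ⟨u, v, hu, hb, hs⟩ := C.exists_forth h1 h2 hx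
    obtain ⟨u', v', hu', hb', hs'⟩ := C.exists_forth ((hs.amalgBase_iff cls_isom).1 hb) hs.symm hx
    have h3 : C.PartialIso (as ++ u ++ v', bs ++ v ++ u') :=
      ⟨⟨hs'.2.1, (hs'.amalgBase_iff cls_isom).1 hb'⟩, hs'.symm⟩
    exact ⟨_, by simp, by simp, ⟨h3.1.1, hs'.1, hs'.symm.tupleSim⟩,
      fun _ => ⟨by simp [hu], by simp [hu']⟩, fun _ => h3⟩
  · obtain ⟨u, v, hu, h⟩ := hσ.exists_forth hx
    obtain ⟨u', v', hu', h'⟩ := PartialInj.exists_forth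
      (as := bs ++ v) (bs := as ++ u) ⟨h.2.1, h.1, h.2.2.symm⟩ hx
    refine ⟨(as ++ u ++ v', bs ++ v ++ u'), by simp, by simp, ⟨h'.2.1, h'.1, h'.2.2.symm⟩,
      fun _ => ⟨List.mem_append_left _ hu, hu'⟩, fun h => absurd h hp⟩

theorem compIn_partialInj : CompIn K.orc (fun σ : List ℕ × List ℕ => PartialInj C.lim σ) := by
  have h1 : CompIn K.orc (fun σ : List ℕ × List ℕ => TupleIn C.lim σ.1) :=
    C.compIn_tupleIn CompIn.fst
  have h2 : CompIn K.orc (fun σ : List ℕ × List ℕ => TupleIn C.lim σ.2) :=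
    C.compIn_tupleIn CompIn.snd
  have h3 : CompIn K.orc (fun σ : List ℕ × List ℕ => ∀ i < σ.1.length, ∀ j < σ.1.length,
      (σ.1.getD i 0 = σ.1.getD j 0 ↔ σ.2.getD i 0 = σ.2.getD j 0)) := by
    refine CompIn.ball_lt (R := fun (σ : List ℕ × List ℕ) i => ∀ j < σ.1.length,
      (σ.1.getD i 0 = σ.1.getD j 0 ↔ σ.2.getD i 0 = σ.2.getD j 0)) ?_ (by fun_prop)
    exact CompIn.ball_lt (R := fun (p : (List ℕ × List ℕ) × ℕ) j =>
      (p.1.1.getD p.2 0 = p.1.1.getD j 0 ↔ p.1.2.getD p.2 0 = p.1.2.getD j 0)) (by fun_prop)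
      (f := fun p : (List ℕ × List ℕ) × ℕ => p.1.1.length) (by fun_prop)
  have h4 : CompIn K.orc (fun σ : List ℕ × List ℕ => σ.1.length = σ.2.length) := by fun_prop
  refine (h1.and (h2.and (h4.and h3))).congr_iff fun σ => ?_
  rw [PartialInj, tupleSim_iff]

theorem isCofinalCollection : IsCofinalCollection C.lim C.bases := by
  refine ⟨fun bs h => h.1, fun as has => ?_, fun bs hbs as has => ?_, fun as has bs hbs hs => ?_⟩
  · obtain ⟨n, hn, h⟩ := C.exists_forall_mem_st has
    exact ⟨C.st n, ⟨(C.isLift_st n).tupleIn, C.base_st hn⟩,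
      fun x hx => InClosure.of_mem (C.isLift_st n).tupleIn x (h x hx)⟩
  · have h1 : TupleIn C.lim (as ++ bs) :=
      TupleIn.append (fun x hx => (has x hx).mem_dom) hbs.1
    have h2 : ∀ x ∈ bs, InClosure C.lim (as ++ bs) x := fun x hx =>
      InClosure.of_mem h1 x (by simp [hx])
    have h3 : ∀ x ∈ as ++ bs, InClosure C.lim bs x := fun x hx => by
      rcases List.mem_append.1 hx with hx | hx
      exacts [has x hx, InClosure.of_mem hbs.1 x hx]
    refine ⟨h1, hbs.2.of_iso cls_isom (f := fun x => x)
      ⟨isEmbMap_sub.codRestrict fun x hx => InClosure.mono h2 hx, fun y hy =>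
        ⟨y, InClosure.mono h3 hy, rfl⟩⟩⟩
  · exact ⟨hbs, (Sim.amalgBase_iff cls_isom ⟨has.1, hbs, hs⟩).1 has.2⟩

variable [hK : FraisseAge K]

theorem compIn_partialIso : CompIn K.orc (fun σ : List ℕ × List ℕ => C.PartialIso σ) :=
  (C.compIn_base CompIn.fst).and (C.compIn_sim CompIn.fst CompIn.snd)

theorem exists_step : ∃ f : (List ℕ × List ℕ) × ℕ → List ℕ × List ℕ, CompIn K.orc f ∧
    ∀ p, PartialInj C.lim p.1 → C.StepRel p.1 p.2 (f p) := by
  have hi := C.compIn_partialInj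
  have hp := C.compIn_partialIso
  refine CompIn.find (R := fun (p : (List ℕ × List ℕ) × ℕ) τ =>
    PartialInj C.lim p.1 → C.StepRel p.1 p.2 τ) ?_ fun p => ?_
  · have h1 : CompIn K.orc (fun q : ((List ℕ × List ℕ) × ℕ) × (List ℕ × List ℕ) =>
        PartialInj C.lim q.1.1) := hi.comp (by fun_prop)
    have h2 : CompIn K.orc (fun q : ((List ℕ × List ℕ) × ℕ) × (List ℕ × List ℕ) =>
        PartialInj C.lim q.2) := hi.comp (by fun_prop)
    have h3 : CompIn K.orc (fun q : ((List ℕ × List ℕ) × ℕ) × (List ℕ × List ℕ) =>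
        C.PartialIso q.1.1) := hp.comp (by fun_prop)
    have h4 : CompIn K.orc (fun q : ((List ℕ × List ℕ) × ℕ) × (List ℕ × List ℕ) =>
        C.PartialIso q.2) := hp.comp (by fun_prop)
    have h5 : CompIn K.orc (fun q : ((List ℕ × List ℕ) × ℕ) × (List ℕ × List ℕ) =>
        q.1.2 ∈ C.lim.dom) := C.compIn_mem_dom (by fun_prop)
    have h6 : CompIn K.orc (fun q : ((List ℕ × List ℕ) × ℕ) × (List ℕ × List ℕ) =>
        q.1.2 ∈ q.2.1) := CompIn.mem (by fun_prop) (by fun_prop)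
    have h7 : CompIn K.orc (fun q : ((List ℕ × List ℕ) × ℕ) × (List ℕ × List ℕ) =>
        q.1.2 ∈ q.2.2) := CompIn.mem (by fun_prop) (by fun_prop)
    have h8 : CompIn K.orc (fun q : ((List ℕ × List ℕ) × ℕ) × (List ℕ × List ℕ) =>
        q.2.1.take q.1.1.1.length = q.1.1.1) := by fun_prop
    have h9 : CompIn K.orc (fun q : ((List ℕ × List ℕ) × ℕ) × (List ℕ × List ℕ) =>
        q.2.2.take q.1.1.2.length = q.1.1.2) := by fun_prop
    exact h1.imp (h8.and (h9.and (h2.and ((h5.imp (h6.and h7)).and (h3.imp h4)))))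
  · by_cases h : PartialInj C.lim p.1
    · obtain ⟨τ, hτ⟩ := C.exists_stepRel h p.2
      exact ⟨τ, fun _ => hτ⟩
    · exact ⟨default, fun hn => absurd hn h⟩

/-- One step of the back-and-forth construction. -/
noncomputable def step : (List ℕ × List ℕ) × ℕ → List ℕ × List ℕ := C.exists_step.choose

/-- The back-and-forth construction started with `σ`. -/
noncomputable def run (σ : List ℕ × List ℕ) : ℕ → List ℕ × List ℕ
  | 0 => σ
  | n + 1 => C.step (run σ n, n)

theorem compIn_run : CompIn K.orc (fun p : (List ℕ × List ℕ) × ℕ => C.run p.1 p.2) := by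
  have hs := C.exists_step.choose_spec.1
  have h1 : CompIn K.orc (fun p : (List ℕ × List ℕ) × ℕ => (C.step p, p.2 + 1)) :=
    hs.prodMk (by fun_prop)
  have h2 : CompIn K.orc (fun p : (List ℕ × List ℕ) × ℕ =>
      ((fun p : (List ℕ × List ℕ) × ℕ => (C.step p, p.2 + 1))^[p.2] (p.1, 0)).1) :=
    CompIn.comp CompIn.fst (CompIn.iterate h1 (by fun_prop) (by fun_prop))
  refine h2.congr fun ⟨σ, n⟩ => ?_
  have : ∀ n, (fun p : (List ℕ × List ℕ) × ℕ => (C.step p, p.2 + 1))^[n] (σ, 0) =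
      (C.run σ n, n) := by
    intro n
    induction n with
    | zero => rfl
    | succ n ih => rw [Function.iterate_succ_apply', ih, run]
  rw [this]

section Run

variable {σ : List ℕ × List ℕ} (hσ : PartialInj C.lim σ)

include hσ

theorem partialInj_run (n : ℕ) : PartialInj C.lim (C.run σ n) := by
  induction n with
  | zero => exact hσ
  | succ n ih => exact (C.exists_step.choose_spec.2 (C.run σ n, n) ih).2.2.1

theorem stepRel_run (n : ℕ) : C.StepRel (C.run σ n) n (C.run σ (n + 1)) :=
  C.exists_step.choose_spec.2 (C.run σ n, n) (C.partialInj_run hσ n)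

theorem run_prefix (n : ℕ) : (C.run σ n).1 <+: (C.run σ (n + 1)).1 ∧
    (C.run σ n).2 <+: (C.run σ (n + 1)).2 := by
  obtain ⟨h1, h2, -⟩ := C.stepRel_run hσ n
  exact ⟨List.prefix_iff_eq_take.2 h1.symm, List.prefix_iff_eq_take.2 h2.symm⟩

theorem partialIso_run (h : C.PartialIso σ) (n : ℕ) : C.PartialIso (C.run σ n) := by
  induction n with
  | zero => exact h
  | succ n ih => exact (C.stepRel_run hσ n).2.2.2.2 ih

end Run

theorem exists_value : ∃ g : (List ℕ × List ℕ) × ℕ → ℕ, CompIn K.orc g ∧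
    ∀ p, PartialInj C.lim p.1 → p.2 ∈ C.lim.dom → ∃ h : ℕ → ℕ,
      (C.run p.1 (p.2 + 1)).1.map h = (C.run p.1 (p.2 + 1)).2 ∧ g p = h p.2 := by
  have hr : CompIn K.orc (fun p : (List ℕ × List ℕ) × ℕ => C.run p.1 (p.2 + 1)) :=
    CompIn.comp (g := fun p : (List ℕ × List ℕ) × ℕ => (p.1, p.2 + 1)) C.compIn_run (by fun_prop)
  obtain ⟨f, hf, hf'⟩ : ∃ f : (List ℕ × List ℕ) × ℕ → ℕ, CompIn K.orc f ∧
      ∀ p : (List ℕ × List ℕ) × ℕ, p.2 ∈ (C.run p.1 (p.2 + 1)).1 →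
        f p < (C.run p.1 (p.2 + 1)).1.length ∧ (C.run p.1 (p.2 + 1)).1.getD (f p) 0 = p.2 := by
    refine CompIn.find (R := fun (p : (List ℕ × List ℕ) × ℕ) i =>
      p.2 ∈ (C.run p.1 (p.2 + 1)).1 → i < (C.run p.1 (p.2 + 1)).1.length ∧
        (C.run p.1 (p.2 + 1)).1.getD i 0 = p.2) ?_ fun p => ?_
    · have hr' : CompIn K.orc (fun q : ((List ℕ × List ℕ) × ℕ) × ℕ => C.run q.1.1 (q.1.2 + 1)) :=
        hr.comp CompIn.fst
      have h1 : CompIn K.orc (fun q : ((List ℕ × List ℕ) × ℕ) × ℕ =>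
        q.1.2 ∈ (C.run q.1.1 (q.1.2 + 1)).1) := CompIn.mem (by fun_prop) (by fun_prop)
      have h2 : CompIn K.orc (fun q : ((List ℕ × List ℕ) × ℕ) × ℕ =>
        q.2 < (C.run q.1.1 (q.1.2 + 1)).1.length ∧
          (C.run q.1.1 (q.1.2 + 1)).1.getD q.2 0 = q.1.2) := by fun_prop
      exact h1.imp h2
    · by_cases h : p.2 ∈ (C.run p.1 (p.2 + 1)).1
      · obtain ⟨i, hi, he⟩ := List.getElem_of_mem h
        exact ⟨i, fun _ => ⟨hi, by rw [List.getD_eq_getElem _ _ hi, he]⟩⟩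
      · exact ⟨0, fun hn => absurd hn h⟩
  refine ⟨fun p => (C.run p.1 (p.2 + 1)).2.getD (f p) 0, by fun_prop, fun p hp hx => ?_⟩
  obtain ⟨h1, h2⟩ := hf' p ((C.stepRel_run hp p.2).2.2.2.1 hx).1
  obtain ⟨h, -, hh, -⟩ := (C.partialInj_run hp (p.2 + 1)).2.2
  refine ⟨h, hh, ?_⟩
  dsimp only
  rw [← hh, List.getD_eq_getElem _ _ (by simpa using h1), List.getElem_map]
  rw [List.getD_eq_getElem _ _ h1] at h2
  rw [h2]

end Chain

/-- A code of the constant function with value `n`. -/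
def OCode.const : ℕ → OCode
  | 0 => zero
  | n + 1 => comp succ (const n)

theorem OCode.eval_const (O : ℕ →. ℕ) (n m : ℕ) : eval O (const n) m = Part.some n := by
  induction n with
  | zero => rfl
  | succ n ih => rw [const, eval_comp ih]; rfl

/-- The s-m-n theorem. -/
theorem CompIn.exists_smn {O : Set ℕ} {g : ℕ × ℕ → ℕ} (hg : CompIn O g) :
    ∃ c : OCode, ∀ n, ∃ c' : OCode, OCode.eval (chi O) c n = Part.some c'.encodeCode ∧
      ComputesIn O c' fun x => g (n, x) := by
  obtain ⟨c₀, h₀⟩ := hg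
  have h1 : CompIn O (fun n : ℕ => (fun m => 4 * Nat.pair 1 m + 6)^[n] 0) :=
    CompIn.iterate (by fun_prop) (by fun_prop) (by fun_prop)
  have h2 : ∀ n, (OCode.const n).encodeCode = (fun m => 4 * Nat.pair 1 m + 6)^[n] 0 := by
    intro n
    induction n with
    | zero => rfl
    | succ n ih => rw [Function.iterate_succ_apply', ← ih]; rfl
  obtain ⟨c, hc⟩ : CompIn O (fun n : ℕ => (OCode.comp c₀ (OCode.pair (OCode.const n)
      (OCode.pair OCode.left OCode.right))).encodeCode) := by
    simp only [OCode.encodeCode, h2]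
    fun_prop
  refine ⟨c, fun n => ⟨_, hc n, fun x => ?_⟩⟩
  have h3 : OCode.eval (chi O) (OCode.pair OCode.left OCode.right) x = Part.some x := by
    rw [OCode.eval_pair (OCode.eval_left x) (OCode.eval_right x), Nat.pair_unpair]
  rw [OCode.eval_comp (OCode.eval_pair (OCode.eval_const _ n x) h3)]
  exact h₀ (n, x)

namespace Chain

variable {K : CompAge L} (C : Chain K) [hK : FraisseAge K]

theorem cofUltraFunIn : CofUltraFunIn K.orc C.lim C.bases := by
  obtain ⟨g, hg, hg'⟩ := C.exists_value
  obtain ⟨c, hc⟩ := CompIn.exists_smn (g := fun p : ℕ × ℕ => g ((CompIn.decodeD _ p.1.unpair.1,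
    CompIn.decodeD _ p.1.unpair.2), p.2)) (hg.comp (by fun_prop))
  refine ⟨c, fun as has bs hbs hs => ?_⟩
  obtain ⟨c', h1, h2⟩ := hc (Nat.pair (Encodable.encode as) (Encodable.encode bs))
  simp only [Nat.unpair_pair, CompIn.decodeD_encode] at h2
  have hi : PartialInj C.lim (as, bs) := ⟨has.1, hbs, hs⟩
  obtain ⟨h3, h4⟩ := bijOnDom_of_approx (C.run_prefix hi) (C.partialInj_run hi)
    (fun n hn => (C.stepRel_run hi n).2.2.2.1 hn) fun x hx => hg' (((as, bs), x)) hi hx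
  refine ⟨_, h1, c', rfl, _, h2, h3, h4 0, fun hcl => ?_⟩
  have hp := C.partialIso_run hi ⟨has, has.1, hbs, hcl⟩
  refine isAutoOf_of_approx h3 (fun u hu => ?_) h4 fun n => (hp n).2
  induction u with
  | nil => exact ⟨0, by simp⟩
  | cons x u ih =>
    have hmono : Monotone fun n => {y | y ∈ (C.run (as, bs) n).1} :=
      monotone_nat_of_le_succ fun n y hy => (C.run_prefix hi n).1.subset hy
    obtain ⟨n, hn⟩ := ih fun y hy => hu y (List.mem_cons_of_mem _ hy)
    refine ⟨max n (x + 1), fun y hy => ?_⟩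
    rcases List.mem_cons.1 hy with rfl | hy
    · exact hmono (le_max_right n (y + 1))
        ((C.stepRel_run hi y).2.2.2.1 (hu y List.mem_cons_self)).1
    · exact hmono (le_max_left n (x + 1)) (hn y hy)

theorem setRecIn_bases : SetRecIn K.orc (ECodes C.bases) := by
  rw [CompIn.setRecIn_iff]
  have h1 : CompIn K.orc (fun n : ℕ => Encodable.encode (CompIn.decodeD (List ℕ) n) = n) := by
    fun_prop
  have h2 : CompIn K.orc (fun n : ℕ => CompIn.decodeD (List ℕ) n ∈ C.bases) :=
    C.compIn_base (by fun_prop)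
  refine (h1.and h2).congr_iff fun n => ?_
  constructor
  · rintro ⟨as, has, rfl⟩
    rw [CompIn.decodeD_encode]
    exact ⟨rfl, has⟩
  · rintro ⟨h, h'⟩
    exact ⟨_, h', h.symm⟩

theorem representsAgeOf : RepresentsAgeOf K C.lim := by
  constructor
  · intro i
    obtain ⟨D, ⟨l, h, hh⟩, ⟨f, hf⟩, g, hg⟩ :=
      hK.joint _ (str_mem_cls i) _ (str_mem_cls (C.k 1))
    have hf' := hh.1.comp hf
    have hg' := hh.1.comp hg
    have hs := (C.isLift_st 1).sim.symm.trans (hg'.sim (C.valid 1).1)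
    obtain ⟨d, hd⟩ := C.exists_ext (C.base_st one_pos) hs (hf'.tupleIn (K.tup_mem i))
    obtain ⟨F, -, hF⟩ := ((hf'.sim (K.tup_mem i)).trans (hd.right hs.length_eq.symm)).2.2
    have hiso : IsIsoMap (K.str i) ((K.str i).sub (K.tup i)) (fun x => x) :=
      ⟨isEmbMap_id.codRestrict fun x hx => (K.gen i x).1 hx,
        fun y hy => ⟨y, InClosure.mem_dom hy, rfl⟩⟩
    exact ⟨d, hd.2.1.right, _, hF.comp hiso⟩
  · rintro B ⟨as, has, f, hf⟩
    obtain ⟨N, hN⟩ := C.directed.exists_lift has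
    obtain ⟨u, hu⟩ := hN N le_rfl
    obtain ⟨F, -, hF⟩ := hu.sim.symm.2.2
    exact cls_isom _ (hK.hereditary _ (str_mem_cls (C.k N)) u hu.1) B ⟨_, hF.comp hf⟩

end Chain

/-- If `𝕂` is a computable age with HP, JEP and coAP, then `𝕂` has an
`EmbedInfo(𝕂)''`-computable cofinal Fraïssé limit. -/
theorem cofinal_fraisse_limit_double_jump {L : Lang} (hL : L.ComputableRep)
    (K : CompAge L) (hK : AgeComputableIn ∅ K)
    (hHP : HP K.cls) (hJEP : JEP K.cls) (hcoAP : CoAP K.cls) :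
    ∃ M : Str L, StrComputableIn (jump (jump (EmbedInfo K))) M ∧
      CompCofUltrahom (jump (jump (EmbedInfo K))) M ∧
      RepresentsAgeOf K M := by
  have : FraisseAge K := ⟨hK, hHP, hJEP, hcoAP⟩
  obtain ⟨C⟩ := exists_chain K
  refine ⟨C.lim, C.strComputableIn, ⟨C.bases, C.isCofinalCollection, C.setRecIn_bases,
    C.cofUltraFunIn⟩, C.representsAgeOf⟩

end CFL
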